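/- arXiv:1309.2111 — 4 statements merged into one kernel-verified Lean document; each statement's English description precedes it below -/
import Mathlib

section
/- Hardy–Littlewood-type rearrangement bound: for any nonzero complex numbers β, γ, any w₀ ∈ ℂ, and 0 < p < 2, (1/π)∫_ℂ |βw₀ + γw|^{-p} e^{-|w|²} dm(w) ≤ |γ|^{-p} Γ(1 - p/2). -/
open MeasureTheory Real
open scoped Real

/-- The centered integral is the largest: pair `w` with `w + a`. -/
lemma centered_integral_le (p : ℝ) (hp0 : 0 < p) (hp2 : p < 2) (a : ℂ) :
    ∫ w : ℂ, ‖w + a‖ ^ (-p) * Real.exp (-‖w‖ ^ 2) ≤ π * Real.Gamma (1 - p / 2) := by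
  have hG : 0 < Real.Gamma (1 - p / 2) := Real.Gamma_pos_of_pos (by linarith)
  have hval : ∫ w : ℂ, ‖w‖ ^ (-p) * Real.exp (-‖w‖ ^ 2) = π * Real.Gamma (1 - p / 2) := by
    have h := Complex.integral_rpow_mul_exp_neg_rpow (p := 2) (q := -p) (by norm_num)
      (by linarith)
    simp only [Real.rpow_two] at h
    rw [h]
    congr 1
    · ring
    · congr 1
      ring
  have hpos : 0 < π * Real.Gamma (1 - p / 2) := by positivity
  have hint : Integrable (fun w : ℂ => ‖w‖ ^ (-p) * Real.exp (-‖w‖ ^ 2)) :=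
    Integrable.of_integral_ne_zero (by rw [hval]; exact hpos.ne')
  by_cases hI : Integrable (fun w : ℂ => ‖w + a‖ ^ (-p) * Real.exp (-‖w‖ ^ 2))
  swap
  · rw [integral_undef hI]; exact hpos.le
  have heq : (fun w : ℂ => ‖w‖ ^ (-p) * Real.exp (-‖w + a‖ ^ 2)) =
      fun w : ℂ => (fun w : ℂ => ‖w + a‖ ^ (-p) * Real.exp (-‖w‖ ^ 2)) (-a - w) := by
    funext w
    have h1 : ‖-a - w + a‖ = ‖w‖ := by rw [← norm_neg w]; congr 1; ring
    have h2 : ‖-a - w‖ = ‖w + a‖ := by rw [← norm_neg (w + a)]; congr 1; ring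
    simp only [h1, h2]
  have hI2 : Integrable (fun w : ℂ => ‖w‖ ^ (-p) * Real.exp (-‖w + a‖ ^ 2)) := by
    rw [heq]; exact hI.comp_sub_left (-a)
  have hv2 : ∫ w : ℂ, ‖w‖ ^ (-p) * Real.exp (-‖w + a‖ ^ 2) =
      ∫ w : ℂ, ‖w + a‖ ^ (-p) * Real.exp (-‖w‖ ^ 2) := by
    rw [heq]
    exact integral_sub_left_eq_self
      (fun w : ℂ => ‖w + a‖ ^ (-p) * Real.exp (-‖w‖ ^ 2)) volume (-a)
  have hint2 : Integrable (fun w : ℂ => ‖w + a‖ ^ (-p) * Real.exp (-‖w + a‖ ^ 2)) :=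
    hint.comp_add_right a
  have hv3 : ∫ w : ℂ, ‖w + a‖ ^ (-p) * Real.exp (-‖w + a‖ ^ 2) =
      ∫ w : ℂ, ‖w‖ ^ (-p) * Real.exp (-‖w‖ ^ 2) :=
    integral_add_right_eq_self (fun w : ℂ => ‖w‖ ^ (-p) * Real.exp (-‖w‖ ^ 2)) a
  have key := integral_mono_ae (hI.add hI2) (hint.add hint2) (by
    filter_upwards [Measure.ae_ne volume (0 : ℂ), Measure.ae_ne volume (-a)] with w h0 h1
    have p0 : 0 < ‖w‖ := norm_pos_iff.mpr h0
    have p1 : 0 < ‖w + a‖ := norm_pos_iff.mpr (fun h => h1 (eq_neg_of_add_eq_zero_left h))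
    simp only [Pi.add_apply]
    rcases le_total ‖w‖ ‖w + a‖ with h | h
    · have e1 := Real.rpow_le_rpow_of_nonpos p0 h (by linarith : -p ≤ 0)
      have e2 : Real.exp (-‖w + a‖ ^ 2) ≤ Real.exp (-‖w‖ ^ 2) := by gcongr
      nlinarith [mul_nonneg (sub_nonneg.2 e1) (sub_nonneg.2 e2)]
    · have e1 := Real.rpow_le_rpow_of_nonpos p1 h (by linarith : -p ≤ 0)
      have e2 : Real.exp (-‖w‖ ^ 2) ≤ Real.exp (-‖w + a‖ ^ 2) := by gcongr
      nlinarith [mul_nonneg (sub_nonneg.2 e1) (sub_nonneg.2 e2)])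
  rw [integral_add' hI hI2, integral_add' hint hint2, hv2, hv3, hval] at key
  linarith

theorem stmt2 (p : ℝ) (hp0 : 0 < p) (hp2 : p < 2)
    (β γ : ℂ) (hβ : β ≠ 0) (hγ : γ ≠ 0) (w₀ : ℂ) :
    (1 / π) * ∫ w : ℂ, ‖β * w₀ + γ * w‖ ^ (-p) * Real.exp (-‖w‖ ^ 2)
      ≤ ‖γ‖ ^ (-p) * Real.Gamma (1 - p / 2) := by
  have h : ∀ w : ℂ, ‖β * w₀ + γ * w‖ ^ (-p) * Real.exp (-‖w‖ ^ 2) =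
      ‖γ‖ ^ (-p) * (‖w + β * w₀ / γ‖ ^ (-p) * Real.exp (-‖w‖ ^ 2)) := by
    intro w
    have : β * w₀ + γ * w = γ * (w + β * w₀ / γ) := by field_simp; ring
    rw [this, norm_mul, Real.mul_rpow (norm_nonneg _) (norm_nonneg _), mul_assoc]
  simp_rw [h]
  rw [integral_const_mul]
  have hc := centered_integral_le p hp0 hp2 (β * w₀ / γ)
  have hg : 0 ≤ ‖γ‖ ^ (-p) := by positivity
  have := mul_le_mul_of_nonneg_left hc hg
  rw [one_div, inv_mul_le_iff₀ Real.pi_pos]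
  linarith
end

section
/- Let ξ₁, ξ₂ be independent standard complex Gaussians, Z₁ = αξ₁, Z₂ = βξ₁ + γξ₂ with α, β, γ nonzero, and suppose |γ/β| < M. Then for 1 < p < 2 there is a constant c > 0 depending only on M and p such that E[|Z₁Z₂|^{-p}] ≤ c |αβ|^{-p} |γ/β|^{2-2p}. -/
open MeasureTheory Real
open scoped Real

lemma aux_exp : Integrable (fun x : ℂ => Real.exp (-‖x‖ ^ 2)) := by
  apply Integrable.of_integral_ne_zero
  have h := Complex.integral_exp_neg_rpow (p := 2) (by norm_num)
  simp only [Real.rpow_two] at h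
  rw [h]
  have := Real.Gamma_pos_of_pos (s := 2 / 2 + 1) (by norm_num)
  positivity

lemma aux_g (p : ℝ) (hp2 : p < 2) :
    Integrable (fun x : ℂ => ‖x‖ ^ (-p) * Real.exp (-‖x‖ ^ 2)) := by
  apply Integrable.of_integral_ne_zero
  have h := Complex.integral_rpow_mul_exp_neg_rpow (p := 2) (q := -p) (by norm_num) (by linarith)
  simp only [Real.rpow_two] at h
  rw [h]
  have := Real.Gamma_pos_of_pos (s := (-p + 2) / 2) (by linarith)
  positivity

lemma aux_h (p : ℝ) (hp1 : 1 < p) :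
    Integrable (fun x : ℂ => (1 + ‖x‖) ^ (-(2 * p))) := by
  apply integrable_one_add_norm
  rw [Complex.finrank_real_complex]
  push_cast
  linarith

/-- Pointwise bound on the product of two singular kernels. -/
lemma aux_pt (p a b : ℝ) (hp1 : 1 < p) (ha : 0 ≤ a) (hb : 0 ≤ b) :
    a ^ (-p) * b ^ (-p) ≤
      (Real.exp 1 * (a ^ (-p) * Real.exp (-a ^ 2))) * (Real.exp 1 * (b ^ (-p) * Real.exp (-b ^ 2)))
      + Real.exp 1 * (a ^ (-p) * Real.exp (-a ^ 2)) + Real.exp 1 * (b ^ (-p) * Real.exp (-b ^ 2))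
      + 2 ^ (2 * p) * (1 + a) ^ (-(2 * p)) + 2 ^ (2 * p) * (1 + b) ^ (-(2 * p)) := by
  have hg : ∀ x : ℝ, 0 ≤ x → x ≤ 1 →
      x ^ (-p) ≤ Real.exp 1 * (x ^ (-p) * Real.exp (-x ^ 2)) := by
    intro x hx hx1
    have h1 : 1 ≤ Real.exp 1 * Real.exp (-x ^ 2) := by
      rw [← Real.exp_add]
      apply Real.one_le_exp
      nlinarith
    have h2 : 0 ≤ x ^ (-p) := Real.rpow_nonneg hx _
    nlinarith
  have hh : ∀ x : ℝ, 1 ≤ x → x ^ (-p) * x ^ (-p) ≤ 2 ^ (2 * p) * (1 + x) ^ (-(2 * p)) := by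
    intro x hx
    rw [← Real.rpow_add (by linarith), Real.rpow_neg (by linarith), ← div_eq_mul_inv,
      ← Real.div_rpow (by norm_num) (by linarith), show -p + -p = -(2 * p) by ring,
      Real.rpow_neg (by linarith), ← Real.inv_rpow (by linarith)]
    apply Real.rpow_le_rpow (by positivity) _ (by linarith)
    rw [inv_eq_one_div, div_le_div_iff₀ (by linarith) (by linarith)]
    linarith
  have h1 : ∀ x : ℝ, 1 ≤ x → x ^ (-p) ≤ 1 := fun x hx =>
    Real.rpow_le_one_of_one_le_of_nonpos hx (by linarith)
  have pa : 0 ≤ a ^ (-p) := Real.rpow_nonneg ha _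
  have pb : 0 ≤ b ^ (-p) := Real.rpow_nonneg hb _
  have qa : 0 ≤ Real.exp 1 * (a ^ (-p) * Real.exp (-a ^ 2)) := by positivity
  have qb : 0 ≤ Real.exp 1 * (b ^ (-p) * Real.exp (-b ^ 2)) := by positivity
  have ra : 0 ≤ 2 ^ (2 * p) * (1 + a) ^ (-(2 * p)) := by positivity
  have rb : 0 ≤ 2 ^ (2 * p) * (1 + b) ^ (-(2 * p)) := by positivity
  have qab := mul_nonneg qa qb
  rcases le_total a 1 with h | h <;> rcases le_total b 1 with h' | h'
  · have := mul_le_mul (hg a ha h) (hg b hb h') pb qa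
    linarith
  · have := mul_le_mul (hg a ha h) (h1 b h') pb qa
    linarith
  · have := mul_le_mul (h1 a h) (hg b hb h') pb zero_le_one
    linarith
  · have := hh a h
    have := hh b h'
    nlinarith [sq_nonneg (a ^ (-p) - b ^ (-p))]

/-- Abstract finiteness. -/
lemma aux_fin (g h e : ℂ → ENNReal) (mg : Measurable g) (mh : Measurable h) (me : Measurable e)
    (he1 : ∀ w, e w ≤ 1)
    (hg : ∫⁻ x, g x ≠ ⊤) (hh : ∫⁻ x, h x ≠ ⊤) (he : ∫⁻ x, e x ≠ ⊤) :
    ∫⁻ u, ∫⁻ w, (g u * g (u + w) + g u + g (u + w) + h u + h (u + w)) * e w ≠ ⊤ := by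
  have hT : ∀ k : ℂ → ENNReal, Measurable k → ∫⁻ x, k x ≠ ⊤ →
      ∫⁻ u, ∫⁻ w, k u * e w ≠ ⊤ := by
    intro k mk hk
    simp_rw [lintegral_const_mul _ me]
    rw [lintegral_mul_const _ mk]
    exact ENNReal.mul_ne_top hk he
  have hS : ∀ k : ℂ → ENNReal, Measurable k → ∫⁻ x, k x ≠ ⊤ →
      ∫⁻ u, ∫⁻ w, k (u + w) * e w ≠ ⊤ := by
    intro k mk hk
    rw [lintegral_lintegral_swap (by fun_prop)]
    have : ∀ w, ∫⁻ u, k (u + w) * e w = (∫⁻ u, k u) * e w := by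
      intro w
      rw [lintegral_mul_const _ (by fun_prop), lintegral_add_right_eq_self k w]
    simp_rw [this]
    rw [lintegral_const_mul _ me]
    exact ENNReal.mul_ne_top hk he
  have hP : ∫⁻ u, ∫⁻ w, g u * g (u + w) * e w ≠ ⊤ := by
    have : ∫⁻ u, ∫⁻ w, g u * g (u + w) * e w ≤ ∫⁻ u, ∫⁻ w, g u * g (u + w) := by
      refine lintegral_mono fun u => lintegral_mono fun w => ?_
      exact mul_le_of_le_one_right' (he1 w)
    refine ne_top_of_le_ne_top ?_ this
    have : ∀ u, ∫⁻ w, g u * g (u + w) = g u * ∫⁻ w, g w := by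
      intro u
      rw [lintegral_const_mul _ (by fun_prop), lintegral_add_left_eq_self g u]
    simp_rw [this]
    rw [lintegral_mul_const _ mg]
    exact ENNReal.mul_ne_top hg hg
  have e1 : ∀ u, ∫⁻ w, (g u * g (u + w) + g u + g (u + w) + h u + h (u + w)) * e w
      = (∫⁻ w, g u * g (u + w) * e w) + (∫⁻ w, g u * e w) + (∫⁻ w, g (u + w) * e w)
        + (∫⁻ w, h u * e w) + (∫⁻ w, h (u + w) * e w) := by
    intro u
    simp_rw [add_mul]
    rw [lintegral_add_left (by fun_prop), lintegral_add_left (by fun_prop),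
      lintegral_add_left (by fun_prop), lintegral_add_left (by fun_prop)]
  have mm : ∀ F : ℂ × ℂ → ENNReal, Measurable F → Measurable fun u => ∫⁻ w, F (u, w) :=
    fun F hF => hF.lintegral_prod_right'
  have m1 := mm (fun x => g x.1 * g (x.1 + x.2) * e x.2) (by fun_prop)
  have m2 := mm (fun x => g x.1 * e x.2) (by fun_prop)
  have m3 := mm (fun x => g (x.1 + x.2) * e x.2) (by fun_prop)
  have m4 := mm (fun x => h x.1 * e x.2) (by fun_prop)
  simp only at m1 m2 m3 m4
  simp_rw [e1]
  rw [lintegral_add_left (by fun_prop), lintegral_add_left (by fun_prop),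
    lintegral_add_left (by fun_prop), lintegral_add_left m1]
  simp only [ne_eq, ENNReal.add_eq_top, not_or]
  exact ⟨⟨⟨⟨hP, hT g mg hg⟩, hS g mg hg⟩, hT h mh hh⟩, hS h mh hh⟩

lemma aux_main (p : ℝ) (hp1 : 1 < p) (hp2 : p < 2) :
    ∫⁻ u : ℂ, ∫⁻ w : ℂ,
      ENNReal.ofReal (‖u‖ ^ (-p) * ‖u + w‖ ^ (-p) * Real.exp (-‖w‖ ^ 2)) ≠ ⊤ := by
  let g : ℂ → ℝ := fun x => Real.exp 1 * (‖x‖ ^ (-p) * Real.exp (-‖x‖ ^ 2))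
  let h : ℂ → ℝ := fun x => 2 ^ (2 * p) * (1 + ‖x‖) ^ (-(2 * p))
  have g0 : ∀ x, 0 ≤ g x := fun x => by positivity
  have h0 : ∀ x, 0 ≤ h x := fun x => by positivity
  have fin : ∀ k : ℂ → ℝ, Integrable k → ∫⁻ x, ENNReal.ofReal (k x) ≠ ⊤ := fun k hk =>
    (hk.lintegral_lt_top).ne
  have key := aux_fin (fun x => ENNReal.ofReal (g x)) (fun x => ENNReal.ofReal (h x))
    (fun x => ENNReal.ofReal (Real.exp (-‖x‖ ^ 2))) (by fun_prop) (by fun_prop) (by fun_prop)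
    (fun w => by
      rw [ENNReal.ofReal_le_one, Real.exp_le_one_iff]
      nlinarith [sq_nonneg ‖w‖])
    (fin _ ((aux_g p hp2).const_mul _)) (fin _ ((aux_h p hp1).const_mul _)) (fin _ aux_exp)
  refine ne_top_of_le_ne_top key ?_
  gcongr with u w
  rw [ENNReal.ofReal_mul (by positivity)]
  gcongr
  rw [← ENNReal.ofReal_mul (g0 _), ← ENNReal.ofReal_add (by positivity) (g0 _),
    ← ENNReal.ofReal_add (by positivity) (g0 _), ← ENNReal.ofReal_add (by positivity) (h0 _),
    ← ENNReal.ofReal_add (by positivity) (h0 _)]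
  exact ENNReal.ofReal_le_ofReal (aux_pt p _ _ hp1 (norm_nonneg _) (norm_nonneg _))

lemma aux_rot (e : ℂ) (he : ‖e‖ = 1) (H : ℂ → ℝ) : ∫ w, H (e * w) = ∫ w, H w := by
  let c : Circle := ⟨e, by simpa [Submonoid.unitSphere] using he⟩
  have hm := (rotation c).measurePreserving
  have := hm.integral_comp (rotation c).toHomeomorph.measurableEmbedding H
  exact this

theorem stmt3 (M p : ℝ) (hM : 0 < M) (hp1 : 1 < p) (hp2 : p < 2) :
    ∃ c > 0, ∀ α β γ : ℂ, α ≠ 0 → β ≠ 0 → γ ≠ 0 → ‖γ / β‖ < M →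
      (1 / π ^ 2) *
          ∫ z : ℂ, ∫ w : ℂ,
            ‖α * z * (β * z + γ * w)‖ ^ (-p) * Real.exp (-‖z‖ ^ 2 - ‖w‖ ^ 2)
        ≤ c * ‖α * β‖ ^ (-p) * ‖γ / β‖ ^ (2 - 2 * p) := by
  set L := ∫⁻ u : ℂ, ∫⁻ w : ℂ,
      ENNReal.ofReal (‖u‖ ^ (-p) * ‖u + w‖ ^ (-p) * Real.exp (-‖w‖ ^ 2)) with hL
  have hLf : L ≠ ⊤ := aux_main p hp1 hp2
  refine ⟨(1 / π ^ 2) * (L.toReal + 1), by positivity, ?_⟩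
  intro α β γ hα hβ hγ _
  set r := ‖γ / β‖ with hr
  have hr0 : 0 < r := norm_pos_iff.mpr (div_ne_zero hγ hβ)
  set J : ℂ → ℝ := fun z => ∫ w : ℂ,
      ‖α * z * (β * z + γ * w)‖ ^ (-p) * Real.exp (-‖z‖ ^ 2 - ‖w‖ ^ 2) with hJ
  have hsc : ∫ z, J z = r ^ 2 * ∫ u, J (r • u) := by
    rw [Measure.integral_comp_smul, Complex.finrank_real_complex, abs_of_pos (by positivity),
      smul_eq_mul, ← mul_assoc, mul_inv_cancel₀ (by positivity), one_mul]
  have he : ‖β * r / γ‖ = 1 := by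
    have hb : ‖β‖ ≠ 0 := norm_ne_zero_iff.mpr hβ
    have hc : ‖γ‖ ≠ 0 := norm_ne_zero_iff.mpr hγ
    rw [norm_div, norm_mul, Complex.norm_real, Real.norm_of_nonneg hr0.le, hr, norm_div]
    field_simp
  have hin : ∀ u, J (r • u) = (‖α * β‖ ^ (-p) * r ^ (-(2 * p))) *
      ∫ w : ℂ, ‖u‖ ^ (-p) * ‖u + w‖ ^ (-p) * Real.exp (-(r * ‖u‖) ^ 2 - ‖w‖ ^ 2) := by
    intro u
    simp only [hJ]
    rw [← aux_rot _ he, ← integral_const_mul]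
    congr 1
    ext w
    have e1 : α * (r • u) * (β * (r • u) + γ * (β * r / γ * w))
        = (α * β) * ((r : ℂ) ^ 2) * (u * (u + w)) := by
      rw [Complex.real_smul]
      field_simp
    rw [e1, norm_mul (β * r / γ) w, he, one_mul, norm_smul, Real.norm_of_nonneg hr0.le, norm_mul,
      norm_mul (α * β), norm_pow, Complex.norm_real, Real.norm_of_nonneg hr0.le, norm_mul u,
      Real.mul_rpow (by positivity) (by positivity), Real.mul_rpow (by positivity) (by positivity),
      Real.mul_rpow (norm_nonneg u) (by positivity), ← Real.rpow_natCast r 2,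
      ← Real.rpow_mul hr0.le, show ((2 : ℕ) : ℝ) * -p = -(2 * p) by push_cast; ring]
    ring
  have hbd : ∫ u : ℂ, ∫ w : ℂ,
      ‖u‖ ^ (-p) * ‖u + w‖ ^ (-p) * Real.exp (-(r * ‖u‖) ^ 2 - ‖w‖ ^ 2) ≤ L.toReal := by
    refine (le_abs_self _).trans ?_
    rw [← Real.norm_eq_abs, ← toReal_enorm]
    refine ENNReal.toReal_mono hLf ?_
    refine (enorm_integral_le_lintegral_enorm _).trans ?_
    refine lintegral_mono fun u => ?_
    refine (enorm_integral_le_lintegral_enorm _).trans ?_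
    refine lintegral_mono fun w => ?_
    rw [Real.enorm_eq_ofReal (by positivity)]
    apply ENNReal.ofReal_le_ofReal
    gcongr
    nlinarith [sq_nonneg (r * ‖u‖)]
  rw [hsc]
  simp_rw [hin]
  rw [integral_const_mul]
  have e2 : r ^ (2 - 2 * p) = r ^ 2 * r ^ (-(2 * p)) := by
    rw [sub_eq_add_neg, Real.rpow_add hr0, Real.rpow_two]
  rw [e2]
  set I := ∫ u : ℂ, ∫ w : ℂ,
      ‖u‖ ^ (-p) * ‖u + w‖ ^ (-p) * Real.exp (-(r * ‖u‖) ^ 2 - ‖w‖ ^ 2)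
  have hI : I ≤ L.toReal + 1 := by linarith
  calc 1 / π ^ 2 * (r ^ 2 * (‖α * β‖ ^ (-p) * r ^ (-(2 * p)) * I))
      = (1 / π ^ 2 * (r ^ 2 * (‖α * β‖ ^ (-p) * r ^ (-(2 * p))))) * I := by ring
    _ ≤ (1 / π ^ 2 * (r ^ 2 * (‖α * β‖ ^ (-p) * r ^ (-(2 * p))))) * (L.toReal + 1) := by
        gcongr
    _ = _ := by ring
end

section
/- Let ξ*, η* be jointly complex Gaussian random variables, each standard complex Gaussian. Then Cov(log|ξ*|, log|η*|) = (1/4) Σ_{k≥1} |E[ξ* conj(η*)]|^{2k} / k². -/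
open MeasureTheory Real
open scoped Real

noncomputable def phi (t y : ℝ) : ℝ := (exp (-t) - exp (-(t * y))) / t

lemma frullani_phi (y : ℝ) (hy : 0 ≤ y) (hint : IntegrableOn (fun t => phi t y) (Set.Ioi 0)) :
    ∫ t in Set.Ioi 0, phi t y = log y := by
  rcases hy.eq_or_lt with rfl | hy
  · exfalso
    have h1 : IntegrableOn (fun t => phi t 0) (Set.Ioi 1) :=
      hint.mono_set (Set.Ioi_subset_Ioi zero_le_one)
    refine not_integrableOn_Ioi_inv (a := 1) ?_
    have h2 : IntegrableOn (fun t => 2 * phi t 0) (Set.Ioi 1) := h1.const_mul 2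
    refine Integrable.mono h2 (by fun_prop) ?_
    refine (ae_restrict_iff' measurableSet_Ioi).2 (Filter.Eventually.of_forall fun t ht => ?_)
    have ht : 1 < t := ht
    have ht0 : 0 < t := by linarith
    have he : exp (-t) ≤ 1 / 2 := by
      rw [exp_neg]
      have : t + 1 ≤ exp t := add_one_le_exp t
      rw [inv_eq_one_div]
      exact one_div_le_one_div_of_le (by norm_num) (by linarith)
    simp only [phi, mul_zero, neg_zero, exp_zero, norm_mul, norm_div, norm_inv, Real.norm_eq_abs]
    rw [abs_of_pos ht0, abs_of_nonpos (by linarith : exp (-t) - 1 ≤ 0), abs_of_pos (by norm_num : (0:ℝ) < 2),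
      ← mul_div_assoc, inv_eq_one_div]
    gcongr
    linarith
  · have hL : Filter.Tendsto (fun x : ℝ => exp (-x)) (nhdsWithin 0 (Set.Ioi 0)) (nhds 1) := by
      have : ContinuousAt (fun x : ℝ => exp (-x)) 0 := by fun_prop
      have h := this.tendsto
      simp only [neg_zero, exp_zero] at h
      exact h.mono_left nhdsWithin_le_nhds
    have hR : Filter.Tendsto (fun x : ℝ => exp (-x)) Filter.atTop (nhds 0) :=
      tendsto_exp_neg_atTop_nhds_zero
    have hf : LocallyIntegrableOn (fun x : ℝ => exp (-x)) (Set.Ioi 0) :=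
      (Continuous.locallyIntegrable (by fun_prop)).locallyIntegrableOn _
    have e : (fun t => phi t y) =
        fun t => t⁻¹ • ((fun x : ℝ => exp (-x)) (1 * t) - (fun x : ℝ => exp (-x)) (y * t)) := by
      funext t
      simp only [phi, smul_eq_mul, one_mul, mul_comm y t]
      ring
    rw [e] at hint ⊢
    rw [Frullani.integral_Ioi_eq hf one_pos hy hL hR hint]
    simp

lemma N_bound (u : ℝ) (hu : 0 < u) :
    (exp (-(2 * u)) - 2 * exp (-u) * (1 / (1 + u)) + 1 / (1 + 2 * u)) / u ^ 2
      ≤ 8 / (1 + u) ^ 3 := by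
  have h1 : exp (-(2 * u)) ≤ 1 / (1 + 2 * u) := by
    rw [exp_neg, inv_eq_one_div]
    exact one_div_le_one_div_of_le (by linarith) (by linarith [add_one_le_exp (2 * u)])
  have h2 : 1 - u ≤ exp (-u) := by linarith [add_one_le_exp (-u)]
  have h3 := exp_pos (-u)
  have hp : 0 < 1 / (1 + u) := by positivity
  rcases le_total u 1 with h | h
  · have : exp (-(2 * u)) - 2 * exp (-u) * (1 / (1 + u)) + 1 / (1 + 2 * u)
        ≤ 2 * (1 / (1 + 2 * u)) - 2 * (1 - u) * (1 / (1 + u)) := by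
      nlinarith
    refine (div_le_div_of_nonneg_right this (by positivity)).trans ?_
    have e : (2 * (1 / (1 + 2 * u)) - 2 * (1 - u) * (1 / (1 + u))) / u ^ 2
        = 4 / ((1 + 2 * u) * (1 + u)) := by
      field_simp
      ring
    rw [e, div_le_div_iff₀ (by positivity) (by positivity)]
    nlinarith [sq_nonneg u, mul_pos hu hu, pow_pos hu 3]
  · have : exp (-(2 * u)) - 2 * exp (-u) * (1 / (1 + u)) + 1 / (1 + 2 * u)
        ≤ 2 * (1 / (1 + 2 * u)) := by
      nlinarith [mul_pos h3 hp]
    refine (div_le_div_of_nonneg_right this (by positivity)).trans ?_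
    have e : (2 * (1 / (1 + 2 * u))) / u ^ 2 = 2 / ((1 + 2 * u) * u ^ 2) := by
      field_simp
    rw [e, div_le_div_iff₀ (by positivity) (by positivity)]
    nlinarith [mul_nonneg (sub_nonneg.2 h) (sub_nonneg.2 h), mul_pos hu hu, pow_pos hu 3, mul_nonneg hu.le (sub_nonneg.2 h), mul_nonneg (mul_pos hu hu).le (sub_nonneg.2 h)]

section abstract_part

variable {Ω : Type*} [MeasurableSpace Ω] {P : Measure Ω} [IsProbabilityMeasure P]

lemma phi_measurable : Measurable (fun q : ℝ × ℝ => phi q.1 q.2) := by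
  unfold phi
  fun_prop

lemma int_exp {X : Ω → ℝ} (hX : Measurable X) (hX0 : ∀ ω, 0 ≤ X ω) {t : ℝ} (ht : 0 ≤ t) :
    Integrable (fun ω => exp (-(t * X ω))) P := by
  refine Integrable.of_bound (by fun_prop) 1 (Filter.Eventually.of_forall fun ω => ?_)
  rw [Real.norm_eq_abs, abs_of_pos (exp_pos _), exp_le_one_iff]
  have := mul_nonneg ht (hX0 ω)
  linarith

lemma int_phi {X : Ω → ℝ} (hX : Measurable X) (hX0 : ∀ ω, 0 ≤ X ω) {t : ℝ} (ht : 0 ≤ t) :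
    Integrable (fun ω => phi t (X ω)) P :=
  ((integrable_const _).sub (int_exp hX hX0 ht)).div_const _

lemma integral_phi {X : Ω → ℝ} (hX : Measurable X) (hX0 : ∀ ω, 0 ≤ X ω)
    (hL : ∀ t, 0 ≤ t → ∫ ω, exp (-(t * X ω)) ∂P = 1 / (1 + t)) {t : ℝ} (ht : 0 ≤ t) :
    ∫ ω, phi t (X ω) ∂P = (exp (-t) - 1 / (1 + t)) / t := by
  unfold phi
  rw [integral_div, integral_sub (integrable_const _) (int_exp hX hX0 ht), hL t ht]
  simp

lemma phi_mul_eq (t u x y : ℝ) : phi t x * phi u y =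
    (exp (-t) * exp (-u) - exp (-t) * exp (-(u * y)) - exp (-u) * exp (-(t * x))
      + exp (-(t * x + u * y))) / (t * u) := by
  unfold phi
  rw [neg_add, exp_add, div_mul_div_comm]
  ring

lemma int_exp2 {X Y : Ω → ℝ} (hX : Measurable X) (hX0 : ∀ ω, 0 ≤ X ω)
    (hY : Measurable Y) (hY0 : ∀ ω, 0 ≤ Y ω) {t u : ℝ} (ht : 0 ≤ t) (hu : 0 ≤ u) :
    Integrable (fun ω => exp (-(t * X ω + u * Y ω))) P := by
  refine Integrable.of_bound (by fun_prop) 1 (Filter.Eventually.of_forall fun ω => ?_)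
  rw [Real.norm_eq_abs, abs_of_pos (exp_pos _), exp_le_one_iff]
  have := mul_nonneg ht (hX0 ω)
  have := mul_nonneg hu (hY0 ω)
  linarith

lemma int_phi_mul {X Y : Ω → ℝ} (hX : Measurable X) (hX0 : ∀ ω, 0 ≤ X ω)
    (hY : Measurable Y) (hY0 : ∀ ω, 0 ≤ Y ω) {t u : ℝ} (ht : 0 ≤ t) (hu : 0 ≤ u) :
    Integrable (fun ω => phi t (X ω) * phi u (Y ω)) P := by
  simp only [phi_mul_eq]
  exact ((((integrable_const _).sub ((int_exp hY hY0 hu).const_mul _)).sub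
    ((int_exp hX hX0 ht).const_mul _)).add (int_exp2 hX hX0 hY hY0 ht hu)).div_const _

lemma integral_phi_mul {X Y : Ω → ℝ} (hX : Measurable X) (hX0 : ∀ ω, 0 ≤ X ω)
    (hY : Measurable Y) (hY0 : ∀ ω, 0 ≤ Y ω)
    (hLX : ∀ t, 0 ≤ t → ∫ ω, exp (-(t * X ω)) ∂P = 1 / (1 + t))
    (hLY : ∀ t, 0 ≤ t → ∫ ω, exp (-(t * Y ω)) ∂P = 1 / (1 + t))
    {t u : ℝ} (ht : 0 ≤ t) (hu : 0 ≤ u) :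
    ∫ ω, phi t (X ω) * phi u (Y ω) ∂P =
      (exp (-t) * exp (-u) - exp (-t) * (1 / (1 + u)) - exp (-u) * (1 / (1 + t))
        + ∫ ω, exp (-(t * X ω + u * Y ω)) ∂P) / (t * u) := by
  simp only [phi_mul_eq]
  have i1 : Integrable (fun ω => exp (-t) * exp (-(u * Y ω))) P := (int_exp hY hY0 hu).const_mul _
  have i2 : Integrable (fun ω => exp (-u) * exp (-(t * X ω))) P := (int_exp hX hX0 ht).const_mul _
  have i0 : Integrable (fun _ : Ω => exp (-t) * exp (-u)) P := integrable_const _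
  have i01 : Integrable (fun ω => exp (-t) * exp (-u) - exp (-t) * exp (-(u * Y ω))) P := i0.sub i1
  have i012 : Integrable (fun ω => exp (-t) * exp (-u) - exp (-t) * exp (-(u * Y ω))
      - exp (-u) * exp (-(t * X ω))) P := i01.sub i2
  rw [integral_div, integral_add i012 (int_exp2 hX hX0 hY hY0 ht hu), integral_sub i01 i2,
    integral_sub i0 i1, integral_const_mul, integral_const_mul, integral_const_mul, hLX t ht, hLY u hu]
  simp

lemma integral_phi_sq {X : Ω → ℝ} (hX : Measurable X) (hX0 : ∀ ω, 0 ≤ X ω)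
    (hLX : ∀ t, 0 ≤ t → ∫ ω, exp (-(t * X ω)) ∂P = 1 / (1 + t)) {t : ℝ} (ht : 0 < t) :
    ∫ ω, phi t (X ω) * phi t (X ω) ∂P ≤ 8 / (1 + t) ^ 3 := by
  rw [integral_phi_mul hX hX0 hX hX0 hLX hLX ht.le ht.le]
  refine le_trans (le_of_eq ?_) (N_bound t ht)
  have e : ∀ ω, -(t * X ω + t * X ω) = -((2 * t) * X ω) := fun ω => by ring
  simp only [e]
  rw [hLX (2 * t) (by positivity), ← exp_add, show -t + -t = -(2 * t) by ring]
  rw [show t * t = t ^ 2 by ring]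
  congr 1
  ring

noncomputable def rr (t : ℝ) : ℝ := (t + 1) ^ (-(3 / 2) : ℝ)

lemma rr_pos {t : ℝ} (ht : 0 < t) : 0 < rr t := by unfold rr; positivity

lemma rr_sq {t : ℝ} (ht : 0 < t) : 8 / (1 + t) ^ 3 = 8 * (rr t * rr t) := by
  unfold rr
  rw [← rpow_add (by positivity), show (-(3 / 2) + -(3 / 2) : ℝ) = -((3 : ℕ) : ℝ) by norm_num,
    rpow_neg (by positivity), rpow_natCast, add_comm]
  rfl

lemma rr_int : Integrable rr (volume.restrict (Set.Ioi 0)) :=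
  integrableOn_add_rpow_Ioi_of_lt (by norm_num) (by norm_num)

lemma bound1 {X : Ω → ℝ} (hX : Measurable X) (hX0 : ∀ ω, 0 ≤ X ω)
    (hLX : ∀ t, 0 ≤ t → ∫ ω, exp (-(t * X ω)) ∂P = 1 / (1 + t)) {t : ℝ} (ht : 0 < t) :
    ∫ ω, ‖phi t (X ω)‖ ∂P ≤ 5 * rr t := by
  have hr := rr_pos ht
  have i1 := int_phi_mul (P := P) hX hX0 hX hX0 ht.le ht.le
  have h1 : ∫ ω, ‖phi t (X ω)‖ ∂P ≤
      ∫ ω, ((1 / (2 * rr t)) * (phi t (X ω) * phi t (X ω)) + rr t / 2) ∂P := by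
    refine integral_mono (int_phi hX hX0 ht.le).norm
      ((i1.const_mul _).add (integrable_const _)) fun ω => ?_
    simp only [Real.norm_eq_abs]
    rw [← abs_mul_abs_self (phi t (X ω))]
    have e : (1 / (2 * rr t)) * (|phi t (X ω)| * |phi t (X ω)|) + rr t / 2 - |phi t (X ω)|
        = (|phi t (X ω)| - rr t) ^ 2 / (2 * rr t) := by
      field_simp
      ring
    have : 0 ≤ (|phi t (X ω)| - rr t) ^ 2 / (2 * rr t) := by positivity
    linarith
  refine h1.trans ?_
  rw [integral_add (i1.const_mul _) (integrable_const _), integral_const_mul]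
  have h2 := integral_phi_sq hX hX0 hLX ht
  rw [rr_sq ht] at h2
  have h3 := mul_le_mul_of_nonneg_left h2 (by positivity : 0 ≤ 1 / (2 * rr t))
  have e : 1 / (2 * rr t) * (8 * (rr t * rr t)) = 4 * rr t := by field_simp; ring
  rw [e] at h3
  simp only [integral_const, probReal_univ, smul_eq_mul, one_mul]
  linarith

lemma bound2 {X Y : Ω → ℝ} (hX : Measurable X) (hX0 : ∀ ω, 0 ≤ X ω)
    (hY : Measurable Y) (hY0 : ∀ ω, 0 ≤ Y ω)
    (hLX : ∀ t, 0 ≤ t → ∫ ω, exp (-(t * X ω)) ∂P = 1 / (1 + t))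
    (hLY : ∀ t, 0 ≤ t → ∫ ω, exp (-(t * Y ω)) ∂P = 1 / (1 + t))
    {t u : ℝ} (ht : 0 < t) (hu : 0 < u) :
    ∫ ω, ‖phi t (X ω) * phi u (Y ω)‖ ∂P ≤ 8 * (rr t * rr u) := by
  have hr := rr_pos ht
  have hs := rr_pos hu
  have i1 := int_phi_mul (P := P) hX hX0 hX hX0 ht.le ht.le
  have i2 := int_phi_mul (P := P) hY hY0 hY hY0 hu.le hu.le
  have h1 : ∫ ω, ‖phi t (X ω) * phi u (Y ω)‖ ∂P ≤
      ∫ ω, ((rr u / (2 * rr t)) * (phi t (X ω) * phi t (X ω)) +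
        (rr t / (2 * rr u)) * (phi u (Y ω) * phi u (Y ω))) ∂P := by
    refine integral_mono (int_phi_mul hX hX0 hY hY0 ht.le hu.le).norm
      ((i1.const_mul _).add (i2.const_mul _)) fun ω => ?_
    simp only [Real.norm_eq_abs, abs_mul]
    rw [← abs_mul_abs_self (phi t (X ω)), ← abs_mul_abs_self (phi u (Y ω))]
    generalize |phi t (X ω)| = a
    generalize |phi u (Y ω)| = b
    have e : rr u / (2 * rr t) * (a * a) + rr t / (2 * rr u) * (b * b) - a * b
        = (a * rr u - b * rr t) ^ 2 / (2 * rr t * rr u) := by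
      field_simp
      ring
    have : 0 ≤ (a * rr u - b * rr t) ^ 2 / (2 * rr t * rr u) := by positivity
    linarith
  refine h1.trans ?_
  rw [integral_add (i1.const_mul _) (i2.const_mul _), integral_const_mul, integral_const_mul]
  have h2 := integral_phi_sq hX hX0 hLX ht
  rw [rr_sq ht] at h2
  have h3 := mul_le_mul_of_nonneg_left h2 (by positivity : 0 ≤ rr u / (2 * rr t))
  have h2' := integral_phi_sq hY hY0 hLY hu
  rw [rr_sq hu] at h2'
  have h3' := mul_le_mul_of_nonneg_left h2' (by positivity : 0 ≤ rr t / (2 * rr u))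
  have e : rr u / (2 * rr t) * (8 * (rr t * rr t)) = 4 * (rr t * rr u) := by field_simp; ring
  have e' : rr t / (2 * rr u) * (8 * (rr u * rr u)) = 4 * (rr t * rr u) := by field_simp; ring
  rw [e] at h3
  rw [e'] at h3'
  linarith

/-- Lebesgue measure on the half line. -/
noncomputable abbrev lam : Measure ℝ := volume.restrict (Set.Ioi 0)

lemma prod_int1 {X : Ω → ℝ} (hX : Measurable X) (hX0 : ∀ ω, 0 ≤ X ω)
    (hLX : ∀ t, 0 ≤ t → ∫ ω, exp (-(t * X ω)) ∂P = 1 / (1 + t)) :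
    Integrable (fun q : Ω × ℝ => phi q.2 (X q.1)) (P.prod lam) := by
  have hm : Measurable (fun q : Ω × ℝ => phi q.2 (X q.1)) :=
    phi_measurable.comp (measurable_snd.prodMk (hX.comp measurable_fst))
  have hpos : ∀ᵐ t ∂lam, 0 < t := ae_restrict_mem measurableSet_Ioi
  rw [integrable_prod_iff' hm.aestronglyMeasurable]
  refine ⟨hpos.mono fun t ht => int_phi hX hX0 ht.le, ?_⟩
  refine Integrable.mono' (rr_int.const_mul 5) ?_ (hpos.mono fun t ht => ?_)
  · exact (hm.aestronglyMeasurable (μ := P.prod lam)).norm.prod_swap.integral_prod_right'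
  · rw [Real.norm_of_nonneg (integral_nonneg fun _ => norm_nonneg _)]
    exact bound1 hX hX0 hLX ht

lemma prod_int2 {X Y : Ω → ℝ} (hX : Measurable X) (hX0 : ∀ ω, 0 ≤ X ω)
    (hY : Measurable Y) (hY0 : ∀ ω, 0 ≤ Y ω)
    (hLX : ∀ t, 0 ≤ t → ∫ ω, exp (-(t * X ω)) ∂P = 1 / (1 + t))
    (hLY : ∀ t, 0 ≤ t → ∫ ω, exp (-(t * Y ω)) ∂P = 1 / (1 + t)) :
    Integrable (fun q : Ω × (ℝ × ℝ) => phi q.2.1 (X q.1) * phi q.2.2 (Y q.1))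
      (P.prod (lam.prod lam)) := by
  have hm : Measurable (fun q : Ω × (ℝ × ℝ) => phi q.2.1 (X q.1) * phi q.2.2 (Y q.1)) := by
    refine Measurable.mul ?_ ?_
    · exact phi_measurable.comp (f := fun q : Ω × (ℝ × ℝ) => (q.2.1, X q.1)) (by fun_prop)
    · exact phi_measurable.comp (f := fun q : Ω × (ℝ × ℝ) => (q.2.2, Y q.1)) (by fun_prop)
  have hpos : ∀ᵐ t ∂(lam.prod lam), 0 < t.1 ∧ 0 < t.2 := by
    rw [Measure.prod_restrict]
    exact ae_restrict_mem (measurableSet_Ioi.prod measurableSet_Ioi)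
  rw [integrable_prod_iff' hm.aestronglyMeasurable]
  refine ⟨hpos.mono fun t ht => int_phi_mul hX hX0 hY hY0 ht.1.le ht.2.le, ?_⟩
  refine Integrable.mono' ((rr_int.mul_prod rr_int).const_mul 8) ?_ (hpos.mono fun t ht => ?_)
  · exact (hm.aestronglyMeasurable (μ := P.prod (lam.prod lam))).norm.prod_swap.integral_prod_right'
  · rw [Real.norm_of_nonneg (integral_nonneg fun _ => norm_nonneg _)]
    exact bound2 hX hX0 hY hY0 hLX hLY ht.1 ht.2

lemma ae_log {X : Ω → ℝ} (hX : Measurable X) (hX0 : ∀ ω, 0 ≤ X ω)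
    (hLX : ∀ t, 0 ≤ t → ∫ ω, exp (-(t * X ω)) ∂P = 1 / (1 + t)) :
    ∀ᵐ ω ∂P, ∫ t, phi t (X ω) ∂lam = log (X ω) := by
  filter_upwards [(prod_int1 hX hX0 hLX).prod_right_ae] with ω hω
  exact frullani_phi _ (hX0 ω) hω

lemma int_log {X : Ω → ℝ} (hX : Measurable X) (hX0 : ∀ ω, 0 ≤ X ω)
    (hLX : ∀ t, 0 ≤ t → ∫ ω, exp (-(t * X ω)) ∂P = 1 / (1 + t)) :
    Integrable (fun ω => log (X ω)) P :=
  ((prod_int1 hX hX0 hLX).integral_prod_left).congr (ae_log hX hX0 hLX)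

lemma mean_log {X : Ω → ℝ} (hX : Measurable X) (hX0 : ∀ ω, 0 ≤ X ω)
    (hLX : ∀ t, 0 ≤ t → ∫ ω, exp (-(t * X ω)) ∂P = 1 / (1 + t)) :
    ∫ ω, log (X ω) ∂P = ∫ t, (exp (-t) - 1 / (1 + t)) / t ∂lam := by
  rw [← integral_congr_ae (ae_log hX hX0 hLX), integral_integral_swap (prod_int1 hX hX0 hLX)]
  refine integral_congr_ae ?_
  filter_upwards [ae_restrict_mem measurableSet_Ioi] with t ht
  exact integral_phi hX hX0 hLX (le_of_lt ht)

lemma mean_int {X : Ω → ℝ} (hX : Measurable X) (hX0 : ∀ ω, 0 ≤ X ω)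
    (hLX : ∀ t, 0 ≤ t → ∫ ω, exp (-(t * X ω)) ∂P = 1 / (1 + t)) :
    Integrable (fun t => (exp (-t) - 1 / (1 + t)) / t) lam := by
  refine ((prod_int1 hX hX0 hLX).integral_prod_right).congr ?_
  filter_upwards [ae_restrict_mem measurableSet_Ioi] with t ht
  exact integral_phi hX hX0 hLX (le_of_lt ht)

lemma ae_loglog {X Y : Ω → ℝ} (hX : Measurable X) (hX0 : ∀ ω, 0 ≤ X ω)
    (hY : Measurable Y) (hY0 : ∀ ω, 0 ≤ Y ω)
    (hLX : ∀ t, 0 ≤ t → ∫ ω, exp (-(t * X ω)) ∂P = 1 / (1 + t))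
    (hLY : ∀ t, 0 ≤ t → ∫ ω, exp (-(t * Y ω)) ∂P = 1 / (1 + t)) :
    ∀ᵐ ω ∂P, ∫ q : ℝ × ℝ, phi q.1 (X ω) * phi q.2 (Y ω) ∂(lam.prod lam)
      = log (X ω) * log (Y ω) := by
  filter_upwards [ae_log hX hX0 hLX, ae_log hY hY0 hLY] with ω h1 h2
  rw [integral_prod_mul (fun t => phi t (X ω)) (fun t => phi t (Y ω)), h1, h2]

lemma int_loglog {X Y : Ω → ℝ} (hX : Measurable X) (hX0 : ∀ ω, 0 ≤ X ω)
    (hY : Measurable Y) (hY0 : ∀ ω, 0 ≤ Y ω)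
    (hLX : ∀ t, 0 ≤ t → ∫ ω, exp (-(t * X ω)) ∂P = 1 / (1 + t))
    (hLY : ∀ t, 0 ≤ t → ∫ ω, exp (-(t * Y ω)) ∂P = 1 / (1 + t)) :
    Integrable (fun ω => log (X ω) * log (Y ω)) P :=
  ((prod_int2 hX hX0 hY hY0 hLX hLY).integral_prod_left).congr (ae_loglog hX hX0 hY hY0 hLX hLY)

lemma cov_log {X Y : Ω → ℝ} (hX : Measurable X) (hX0 : ∀ ω, 0 ≤ X ω)
    (hY : Measurable Y) (hY0 : ∀ ω, 0 ≤ Y ω)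
    (hLX : ∀ t, 0 ≤ t → ∫ ω, exp (-(t * X ω)) ∂P = 1 / (1 + t))
    (hLY : ∀ t, 0 ≤ t → ∫ ω, exp (-(t * Y ω)) ∂P = 1 / (1 + t)) :
    (∫ ω, log (X ω) * log (Y ω) ∂P) - (∫ ω, log (X ω) ∂P) * (∫ ω, log (Y ω) ∂P)
      = ∫ q : ℝ × ℝ, ((∫ ω, exp (-(q.1 * X ω + q.2 * Y ω)) ∂P)
          - 1 / ((1 + q.1) * (1 + q.2))) / (q.1 * q.2) ∂(lam.prod lam) := by
  have hI := prod_int2 hX hX0 hY hY0 hLX hLY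
  have hm := mean_int hX hX0 hLX
  rw [mean_log hX hX0 hLX, mean_log hY hY0 hLY, ← integral_prod_mul,
    ← integral_congr_ae (ae_loglog hX hX0 hY hY0 hLX hLY),
    integral_integral_swap (f := fun ω (q : ℝ × ℝ) => phi q.1 (X ω) * phi q.2 (Y ω)) hI,
    ← integral_sub hI.integral_prod_right (hm.mul_prod hm)]
  refine integral_congr_ae ?_
  have hpos : ∀ᵐ t ∂(lam.prod lam), 0 < t.1 ∧ 0 < t.2 := by
    rw [Measure.prod_restrict]
    exact ae_restrict_mem (measurableSet_Ioi.prod measurableSet_Ioi)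
  filter_upwards [hpos] with q hq
  obtain ⟨h1, h2⟩ := hq
  rw [integral_phi_mul hX hX0 hY hY0 hLX hLY h1.le h2.le, div_mul_div_comm, ← sub_div]
  congr 1
  have : 1 + q.1 ≠ 0 := by positivity
  have : 1 + q.2 ≠ 0 := by positivity
  field_simp
  ring

end abstract_part

lemma beta_deriv (k : ℕ) (x : ℝ) (hx : 0 ≤ x) :
    HasDerivAt (fun t : ℝ => (t / (1 + t)) ^ (k + 1) / (k + 1)) (x ^ k / (1 + x) ^ (k + 2)) x := by
  have h1 : 1 + x ≠ 0 := by positivity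
  have h2 : ((k : ℝ) + 1) ≠ 0 := by positivity
  have := (((hasDerivAt_id x).div ((hasDerivAt_id x).const_add 1) h1).pow (k + 1)).div_const
    ((k : ℝ) + 1)
  refine this.congr_deriv ?_
  simp only [id, Nat.cast_add, Nat.cast_one, Nat.add_sub_cancel, Pi.div_apply]
  rw [div_pow]
  field_simp
  ring

lemma beta_tendsto (k : ℕ) :
    Filter.Tendsto (fun t : ℝ => (t / (1 + t)) ^ (k + 1) / (k + 1)) Filter.atTop
      (nhds (1 / (k + 1))) := by
  have h : Filter.Tendsto (fun t : ℝ => t / (1 + t)) Filter.atTop (nhds 1) := by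
    have h0 : Filter.Tendsto (fun t : ℝ => 1 - (1 + t)⁻¹) Filter.atTop (nhds (1 - 0)) :=
      tendsto_const_nhds.sub
        (tendsto_inv_atTop_zero.comp (Filter.tendsto_atTop_add_const_left _ 1 Filter.tendsto_id))
    rw [sub_zero] at h0
    refine h0.congr' ?_
    filter_upwards [Filter.eventually_gt_atTop 0] with t ht
    have : 1 + t ≠ 0 := by positivity
    field_simp
    ring
  simpa using (h.pow (k + 1)).div_const ((k : ℝ) + 1)

lemma beta_int (k : ℕ) : Integrable (fun x : ℝ => x ^ k / (1 + x) ^ (k + 2)) lam :=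
  integrableOn_Ioi_deriv_of_nonneg' (fun x hx => beta_deriv k x hx)
    (fun x hx => by have : 0 < x := hx; positivity) (beta_tendsto k)

lemma beta_integral (k : ℕ) : ∫ x, x ^ k / (1 + x) ^ (k + 2) ∂lam = 1 / ((k : ℝ) + 1) := by
  have := integral_Ioi_of_hasDerivAt_of_tendsto' (fun x hx => beta_deriv k x hx) (beta_int k)
    (beta_tendsto k)
  rw [this]
  simp

lemma dilog_integral (b : ℝ) (hb0 : 0 ≤ b) (hb1 : b ≤ 1) :
    ∫ q : ℝ × ℝ, b / ((1 + q.1 + q.2 + q.1 * q.2 * (1 - b)) * ((1 + q.1) * (1 + q.2)))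
      ∂(lam.prod lam) = ∑' k : ℕ, b ^ (k + 1) / ((k : ℝ) + 1) ^ 2 := by
  let F : ℕ → ℝ × ℝ → ℝ := fun k q =>
    b ^ (k + 1) * ((q.1 ^ k / (1 + q.1) ^ (k + 2)) * (q.2 ^ k / (1 + q.2) ^ (k + 2)))
  have hpos : ∀ᵐ t ∂(lam.prod lam), 0 < t.1 ∧ 0 < t.2 := by
    rw [Measure.prod_restrict]
    exact ae_restrict_mem (measurableSet_Ioi.prod measurableSet_Ioi)
  have hF : ∀ k, Integrable (F k) (lam.prod lam) := fun k =>
    ((beta_int k).mul_prod (beta_int k)).const_mul _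
  have hFi : ∀ k, ∫ q, F k q ∂(lam.prod lam) = b ^ (k + 1) / ((k : ℝ) + 1) ^ 2 := fun k => by
    simp only [F]
    rw [integral_const_mul, integral_prod_mul (fun x : ℝ => x ^ k / (1 + x) ^ (k + 2))
      (fun x : ℝ => x ^ k / (1 + x) ^ (k + 2)), beta_integral]
    field_simp
  have hFn : ∀ k, ∫ q, ‖F k q‖ ∂(lam.prod lam) = b ^ (k + 1) / ((k : ℝ) + 1) ^ 2 := fun k => by
    rw [← hFi k]
    refine integral_congr_ae ?_
    filter_upwards [hpos] with q hq
    obtain ⟨h1, h2⟩ := hq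
    exact Real.norm_of_nonneg (by simp only [F]; positivity)
  have hs : Summable fun k => ∫ q, ‖F k q‖ ∂(lam.prod lam) := by
    simp only [hFn]
    have h0 : Summable fun k : ℕ => 1 / ((k : ℝ) + 1) ^ 2 := by
      have := (summable_nat_add_iff 1).2 (Real.summable_one_div_nat_pow.2 (one_lt_two))
      simpa using this
    refine h0.of_nonneg_of_le (fun k => by positivity) fun k => ?_
    gcongr
    exact pow_le_one₀ hb0 hb1
  have key := (hasSum_integral_of_summable_integral_norm hF hs).tsum_eq
  simp only [hFi] at key
  rw [key]
  refine integral_congr_ae ?_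
  filter_upwards [hpos] with q hq
  obtain ⟨h1, h2⟩ := hq
  have hx : q.1 / (1 + q.1) < 1 := by rw [div_lt_one (by positivity)]; linarith
  have hy : q.2 / (1 + q.2) < 1 := by rw [div_lt_one (by positivity)]; linarith
  have hx0 : 0 ≤ q.1 / (1 + q.1) := by positivity
  have hy0 : 0 ≤ q.2 / (1 + q.2) := by positivity
  have hr : b * (q.1 / (1 + q.1) * (q.2 / (1 + q.2))) < 1 := by
    have : q.1 / (1 + q.1) * (q.2 / (1 + q.2)) < 1 := mul_lt_one_of_nonneg_of_lt_one_left hx0 hx hy.le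
    have h0 := mul_nonneg hx0 hy0
    nlinarith
  have e : ∀ k, F k q = (b * (q.1 / (1 + q.1) * (q.2 / (1 + q.2)))) ^ k *
      (b / ((1 + q.1) ^ 2 * (1 + q.2) ^ 2)) := fun k => by
    simp only [F, mul_pow, div_pow]
    field_simp
    ring
  simp only [e]
  rw [tsum_mul_right, tsum_geometric_of_lt_one (by positivity) hr]
  have h3 : (1 - b * (q.1 / (1 + q.1) * (q.2 / (1 + q.2)))) =
      (1 + q.1 + q.2 + q.1 * q.2 * (1 - b)) / ((1 + q.1) * (1 + q.2)) := by
    field_simp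
    ring
  have h4 : 0 < 1 + q.1 + q.2 + q.1 * q.2 * (1 - b) := by
    have := mul_nonneg (mul_pos h1 h2).le (sub_nonneg.2 hb1)
    linarith
  rw [h3]
  field_simp

lemma gauss_real (b c : ℝ) (hb : 0 < b) (w : ℂ) :
    ∫ v : ℂ, exp (-b * ‖v‖ ^ 2 + c * inner ℝ w v) = π / b * exp (c ^ 2 * ‖w‖ ^ 2 / (4 * b)) := by
  have h := GaussianFourier.integral_cexp_neg_mul_sq_norm_add (b := (b : ℂ)) (by simpa using hb)
    (c : ℂ) w
  rw [Complex.finrank_real_complex] at h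
  have e : ∀ v : ℂ, Complex.exp (-(b : ℂ) * (‖v‖ : ℂ) ^ 2 + (c : ℂ) * ((inner ℝ w v : ℝ) : ℂ))
      = ((exp (-b * ‖v‖ ^ 2 + c * inner ℝ w v) : ℝ) : ℂ) := fun v => by push_cast; rfl
  simp only [e] at h
  rw [integral_complex_ofReal] at h
  rw [show ((2 : ℕ) : ℂ) / 2 = 1 by norm_num, Complex.cpow_one] at h
  exact_mod_cast h

/-- The standard complex Gaussian measure. -/
noncomputable def gmu : Measure ℂ :=
  volume.withDensity (fun z => ENNReal.ofReal (exp (-‖z‖ ^ 2) / π))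

lemma gmu_integral (f : ℂ → ℝ) : ∫ z, f z ∂gmu = ∫ z, exp (-‖z‖ ^ 2) / π * f z := by
  unfold gmu
  rw [integral_withDensity_eq_integral_toReal_smul (by fun_prop)
    (Filter.Eventually.of_forall fun _ => ENNReal.ofReal_lt_top)]
  refine integral_congr_ae (Filter.Eventually.of_forall fun z => ?_)
  simp only [smul_eq_mul]
  rw [ENNReal.toReal_ofReal (by positivity)]

lemma gmu_gauss (a γ : ℂ) (u : ℝ) (hu : 0 ≤ u) :
    ∫ w, exp (-(u * ‖a + γ * w‖ ^ 2)) ∂gmu =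
      1 / (1 + u * ‖γ‖ ^ 2) * exp (-(u / (1 + u * ‖γ‖ ^ 2) * ‖a‖ ^ 2)) := by
  have hb : 0 < 1 + u * ‖γ‖ ^ 2 := by positivity
  rw [gmu_integral]
  have e : ∀ w : ℂ, exp (-‖w‖ ^ 2) / π * exp (-(u * ‖a + γ * w‖ ^ 2)) =
      exp (-(u * ‖a‖ ^ 2)) / π * exp (-(1 + u * ‖γ‖ ^ 2) * ‖w‖ ^ 2 +
        (-2 * u) * inner ℝ ((starRingEnd ℂ) γ * a) w) := fun w => by
    have e1 : ‖a + γ * w‖ ^ 2 = ‖a‖ ^ 2 + 2 * inner ℝ ((starRingEnd ℂ) γ * a) w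
        + ‖γ‖ ^ 2 * ‖w‖ ^ 2 := by
      rw [← mul_pow, ← norm_mul, norm_add_sq_real]
      congr 3
      simp only [Complex.inner, map_mul, Complex.conj_conj, Complex.mul_re, Complex.mul_im,
        Complex.conj_re, Complex.conj_im]
      ring
    rw [e1, div_mul_eq_mul_div, div_mul_eq_mul_div, ← exp_add, ← exp_add]
    congr 2
    ring
  simp only [e]
  rw [integral_const_mul, gauss_real _ _ hb, norm_mul, Complex.norm_conj]
  have e2 : -(u / (1 + u * ‖γ‖ ^ 2) * ‖a‖ ^ 2) = -(u * ‖a‖ ^ 2) +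
      (-2 * u) ^ 2 * (‖γ‖ * ‖a‖) ^ 2 / (4 * (1 + u * ‖γ‖ ^ 2)) := by
    field_simp
    ring
  rw [e2, exp_add]
  field_simp

instance : IsProbabilityMeasure gmu := by
  have hi : Integrable (fun z : ℂ => exp (-‖z‖ ^ 2) / π) := by
    by_contra hni
    have h := gmu_gauss 0 0 0 le_rfl
    rw [gmu_integral] at h
    simp at h
    rw [integral_undef (by simpa using hni)] at h
    norm_num at h
  constructor
  have h := gmu_gauss 0 0 0 le_rfl
  rw [gmu_integral] at h
  simp only [zero_mul, neg_zero, exp_zero, mul_one, add_zero, div_one, norm_zero] at h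
  unfold gmu
  rw [withDensity_apply _ MeasurableSet.univ, Measure.restrict_univ,
    ← ofReal_integral_eq_lintegral_ofReal hi (Filter.Eventually.of_forall fun z => by positivity)]
  simp [h]

lemma laplace_joint (β γ : ℂ) (h : ‖β‖ ^ 2 + ‖γ‖ ^ 2 = 1) (t u : ℝ) (ht : 0 ≤ t) (hu : 0 ≤ u) :
    ∫ p : ℂ × ℂ, exp (-(t * ‖p.1‖ ^ 2 + u * ‖β * p.1 + γ * p.2‖ ^ 2)) ∂(gmu.prod gmu) =
      1 / (1 + t + u + t * u * (1 - ‖β‖ ^ 2)) := by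
  have hI : Integrable (fun p : ℂ × ℂ => exp (-(t * ‖p.1‖ ^ 2 + u * ‖β * p.1 + γ * p.2‖ ^ 2)))
      (gmu.prod gmu) :=
    int_exp2 (X := fun p : ℂ × ℂ => ‖p.1‖ ^ 2) (Y := fun p : ℂ × ℂ => ‖β * p.1 + γ * p.2‖ ^ 2)
      (by fun_prop) (fun _ => by positivity) (by fun_prop) (fun _ => by positivity) ht hu
  rw [integral_prod _ hI]
  simp only [neg_add, exp_add]
  simp only [integral_const_mul, gmu_gauss _ _ _ hu]
  have hb : 0 < 1 + u * ‖γ‖ ^ 2 := by positivity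
  have e : ∀ z : ℂ, exp (-(t * ‖z‖ ^ 2)) * (1 / (1 + u * ‖γ‖ ^ 2) *
      exp (-(u / (1 + u * ‖γ‖ ^ 2) * ‖β * z‖ ^ 2))) = 1 / (1 + u * ‖γ‖ ^ 2) *
      exp (-((t + u * ‖β‖ ^ 2 / (1 + u * ‖γ‖ ^ 2)) * ‖0 + 1 * z‖ ^ 2)) := fun z => by
    rw [mul_left_comm, ← exp_add, zero_add, one_mul, norm_mul]
    congr 2
    ring
  simp only [e]
  rw [integral_const_mul, gmu_gauss _ _ _ (by positivity)]
  have e3 : 1 + t + u + t * u * (1 - ‖β‖ ^ 2) = (1 + t) * (1 + u * ‖γ‖ ^ 2) + u * ‖β‖ ^ 2 := by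
    linear_combination (-(u + t * u)) * h
  rw [e3]
  simp only [norm_zero, norm_one]
  have : 0 < (1 + t) * (1 + u * ‖γ‖ ^ 2) + u * ‖β‖ ^ 2 := by positivity
  norm_num
  rw [← mul_inv]
  congr 1
  field_simp
  ring

lemma iter_eq (f : ℂ → ℂ → ℝ)
    (hf : Integrable (fun p : ℂ × ℂ => f p.1 p.2) (gmu.prod gmu)) :
    (1 / π ^ 2) * ∫ z : ℂ, ∫ w : ℂ, f z w * exp (-‖z‖ ^ 2 - ‖w‖ ^ 2) =
      ∫ p : ℂ × ℂ, f p.1 p.2 ∂(gmu.prod gmu) := by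
  rw [integral_prod _ hf, gmu_integral, ← integral_const_mul]
  congr 1
  funext z
  rw [gmu_integral, ← integral_const_mul, ← integral_const_mul]
  congr 1
  funext w
  rw [sub_eq_add_neg, exp_add]
  field_simp

lemma log_half (x : ℝ) : log x = 1 / 2 * log (x ^ 2) := by
  rw [log_pow]; push_cast; ring

theorem stmt6 (β γ : ℂ) (h : ‖β‖ ^ 2 + ‖γ‖ ^ 2 = 1) :
    ((1 / π ^ 2) *
        ∫ z : ℂ, ∫ w : ℂ,
          Real.log ‖z‖ * Real.log ‖β * z + γ * w‖ * Real.exp (-‖z‖ ^ 2 - ‖w‖ ^ 2))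
      - ((1 / π ^ 2) *
          ∫ z : ℂ, ∫ w : ℂ, Real.log ‖z‖ * Real.exp (-‖z‖ ^ 2 - ‖w‖ ^ 2)) *
        ((1 / π ^ 2) *
          ∫ z : ℂ, ∫ w : ℂ, Real.log ‖β * z + γ * w‖ * Real.exp (-‖z‖ ^ 2 - ‖w‖ ^ 2))
      = (1 / 4) * ∑' k : ℕ, ‖β‖ ^ (2 * (k + 1)) / ((k : ℝ) + 1) ^ 2 := by
  have hX : Measurable (fun p : ℂ × ℂ => ‖p.1‖ ^ 2) := by fun_prop
  have hX0 : ∀ p : ℂ × ℂ, 0 ≤ ‖p.1‖ ^ 2 := fun _ => by positivity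
  have hY : Measurable (fun p : ℂ × ℂ => ‖β * p.1 + γ * p.2‖ ^ 2) := by fun_prop
  have hY0 : ∀ p : ℂ × ℂ, 0 ≤ ‖β * p.1 + γ * p.2‖ ^ 2 := fun _ => by positivity
  have hLX : ∀ t, 0 ≤ t → ∫ p : ℂ × ℂ, exp (-(t * ‖p.1‖ ^ 2)) ∂(gmu.prod gmu) = 1 / (1 + t) :=
    fun t ht => by simpa using laplace_joint β γ h t 0 ht le_rfl
  have hLY : ∀ t, 0 ≤ t → ∫ p : ℂ × ℂ, exp (-(t * ‖β * p.1 + γ * p.2‖ ^ 2)) ∂(gmu.prod gmu)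
      = 1 / (1 + t) :=
    fun t ht => by simpa using laplace_joint β γ h 0 t le_rfl ht
  have i1 : Integrable (fun p : ℂ × ℂ => log ‖p.1‖) (gmu.prod gmu) := by
    simp only [log_half ‖_‖]
    exact (int_log hX hX0 hLX).const_mul _
  have i2 : Integrable (fun p : ℂ × ℂ => log ‖β * p.1 + γ * p.2‖) (gmu.prod gmu) := by
    simp only [log_half ‖_‖]
    exact (int_log hY hY0 hLY).const_mul _
  have e12 : ∀ p : ℂ × ℂ, log ‖p.1‖ * log ‖β * p.1 + γ * p.2‖ =
      1 / 4 * (log (‖p.1‖ ^ 2) * log (‖β * p.1 + γ * p.2‖ ^ 2)) := fun p => by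
    rw [log_half ‖p.1‖, log_half ‖β * p.1 + γ * p.2‖]; ring
  have i12 : Integrable (fun p : ℂ × ℂ => log ‖p.1‖ * log ‖β * p.1 + γ * p.2‖)
      (gmu.prod gmu) := by
    simp only [e12]
    exact (int_loglog hX hX0 hY hY0 hLX hLY).const_mul _
  rw [iter_eq (fun z w => log ‖z‖ * log ‖β * z + γ * w‖) i12, iter_eq (fun z _ => log ‖z‖) i1,
    iter_eq (fun z w => log ‖β * z + γ * w‖) i2]
  simp only [e12]
  have e1 : ∫ p : ℂ × ℂ, log ‖p.1‖ ∂(gmu.prod gmu)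
      = 1 / 2 * ∫ p : ℂ × ℂ, log (‖p.1‖ ^ 2) ∂(gmu.prod gmu) := by
    rw [← integral_const_mul]; simp only [← log_half]
  have e2 : ∫ p : ℂ × ℂ, log ‖β * p.1 + γ * p.2‖ ∂(gmu.prod gmu)
      = 1 / 2 * ∫ p : ℂ × ℂ, log (‖β * p.1 + γ * p.2‖ ^ 2) ∂(gmu.prod gmu) := by
    rw [← integral_const_mul]; simp only [← log_half]
  rw [e1, e2, integral_const_mul]
  have hc := cov_log hX hX0 hY hY0 hLX hLY
  have hb1 : ‖β‖ ^ 2 ≤ 1 := by nlinarith [sq_nonneg ‖γ‖]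
  have hd := dilog_integral (‖β‖ ^ 2) (by positivity) hb1
  have hJ : ∫ q : ℝ × ℝ, ((∫ p : ℂ × ℂ, exp (-(q.1 * ‖p.1‖ ^ 2 +
        q.2 * ‖β * p.1 + γ * p.2‖ ^ 2)) ∂(gmu.prod gmu))
          - 1 / ((1 + q.1) * (1 + q.2))) / (q.1 * q.2) ∂(lam.prod lam) =
      ∑' k : ℕ, (‖β‖ ^ 2) ^ (k + 1) / ((k : ℝ) + 1) ^ 2 := by
    rw [← hd]
    refine integral_congr_ae ?_
    have hpos : ∀ᵐ t ∂(lam.prod lam), 0 < t.1 ∧ 0 < t.2 := by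
      rw [Measure.prod_restrict]
      exact ae_restrict_mem (measurableSet_Ioi.prod measurableSet_Ioi)
    filter_upwards [hpos] with q hq
    obtain ⟨h1, h2⟩ := hq
    have h4 : 0 < 1 + q.1 + q.2 + q.1 * q.2 * (1 - ‖β‖ ^ 2) := by
      have := mul_nonneg (mul_pos h1 h2).le (sub_nonneg.2 hb1)
      linarith
    rw [laplace_joint β γ h _ _ h1.le h2.le]
    have h5 : 0 < (1 + q.1) * (1 + q.2) := by positivity
    rw [div_sub_div _ _ h4.ne' h5.ne', div_div, div_eq_div_iff (by positivity) (by positivity)]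
    ring
  rw [hJ] at hc
  simp only [pow_mul]
  rw [← hc]
  ring
end

section
/- For centered complex Gaussian random variables ξ ~ N_ℂ(0,σ²) and η ~ N_ℂ(0,τ²) (jointly Gaussian, σ,τ > 0), Cov(log|ξ|, log|η|) = (1/4) Σ_{k≥1} (1/k²) (|E[ξ conj(η)]|² / (E|ξ|² E|η|²))^k. -/
open MeasureTheory Real
open scoped Real ComplexConjugate


lemma radial_int (f : ℝ → ℝ) : ∫ z : ℂ, f (‖z‖ ^ 2) = π * ∫ s in Set.Ioi (0:ℝ), f s := by
  rw [integral_fun_norm_addHaar (volume : Measure ℂ) (fun r => f (r ^ 2)),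
    ← integral_comp_rpow_Ioi_of_pos (g := f) (p := 2) two_pos]
  have hv : (volume : Measure ℂ).real (Metric.ball 0 1) = π := by
    simp [Measure.real, Complex.volume_ball]
  rw [hv, Complex.finrank_real_complex, nsmul_eq_mul, smul_eq_mul, ← mul_assoc, mul_comm (_ : ℝ) π, mul_assoc]
  congr 1
  rw [← integral_const_mul]
  apply setIntegral_congr_fun measurableSet_Ioi
  intro s hs
  norm_num
  ring

lemma gauss_int : Integrable (fun w : ℂ => Real.exp (-‖w‖ ^ 2)) := by
  have := GaussianFourier.integrable_cexp_neg_mul_sq_norm_add (V := ℂ) (b := 1) (by simp) 0 0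
  refine this.norm.congr (Filter.Eventually.of_forall fun w => ?_)
  simp [Complex.norm_exp, ← Complex.ofReal_pow]

lemma abs_log_le {x : ℝ} (hx : 0 ≤ x) : |Real.log x| ≤ x + x⁻¹ := by
  rcases hx.eq_or_lt with rfl | hx
  · simp
  · rw [abs_le]
    have h1 := Real.log_le_sub_one_of_pos hx
    have h2 := Real.log_le_sub_one_of_pos (inv_pos.2 hx)
    rw [Real.log_inv] at h2
    have := inv_pos.2 hx
    constructor <;> linarith

lemma inv_int : Integrable (fun w : ℂ => (Metric.ball (0:ℂ) 1).indicator (fun w => ‖w‖⁻¹) w) := by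
  rw [integrable_indicator_iff measurableSet_ball,
    integrableOn_fun_norm_addHaar (volume : Measure ℂ) (f := fun r => r⁻¹)]
  rw [integrableOn_congr_fun (g := fun _ => (1:ℝ)) _ measurableSet_Ioo]
  · simp
  · intro y hy
    have := hy.1
    simp [this.ne']

lemma norm_gauss_int : Integrable (fun w : ℂ => ‖w‖ * Real.exp (-‖w‖ ^ 2)) := by
  rw [integrable_fun_norm_addHaar (volume : Measure ℂ) (f := fun r => r * Real.exp (-r ^ 2))]
  have := integrableOn_rpow_mul_exp_neg_mul_sq (b := 1) one_pos (s := 2) (by norm_num)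
  refine this.congr_fun (fun x hx => ?_) measurableSet_Ioi
  simp; ring

lemma log_gauss_int (c : ℂ) :
    Integrable (fun w : ℂ => Real.log ‖c + w‖ * Real.exp (-‖w‖ ^ 2)) := by
  have h1 := (inv_int.comp_add_left c).add
    ((gauss_int.const_mul (‖c‖ + 1)).add norm_gauss_int)
  refine h1.mono' (by fun_prop) (Filter.Eventually.of_forall fun w => ?_)
  have he : Real.exp (-‖w‖ ^ 2) ≤ 1 := by
    rw [Real.exp_le_one_iff]; nlinarith [sq_nonneg ‖w‖]
  have he0 := Real.exp_pos (-‖w‖ ^ 2)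
  have hl := abs_log_le (norm_nonneg (c + w))
  have ht := norm_add_le c w
  rw [norm_mul, Real.norm_eq_abs, Real.norm_eq_abs, abs_of_pos he0]
  simp only [Pi.add_apply, Set.indicator, Metric.mem_ball, dist_zero_right]
  split_ifs with h
  · have hi : 0 ≤ ‖c + w‖⁻¹ := by positivity
    nlinarith [mul_le_mul_of_nonneg_right hl he0.le, mul_le_mul_of_nonneg_left he hi, mul_le_mul_of_nonneg_right ht he0.le]
  · have hi : ‖c + w‖⁻¹ ≤ 1 := inv_le_one_of_one_le₀ (not_lt.1 h)
    nlinarith [mul_le_mul_of_nonneg_right (hl.trans (add_le_add ht hi)) he0.le]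

lemma rot_int (f : ℂ → ℝ) (θ : ℝ) : ∫ w, f (circleMap 0 1 θ * w) = ∫ w, f w := by
  have h := (rotation (Circle.exp θ)).measurePreserving
  have := h.integral_comp (rotation (Circle.exp θ)).toHomeomorph.measurableEmbedding f
  rw [← this]
  simp [circleMap, rotation_apply]

lemma jensen_int (c : ℂ) :
    ∫ w : ℂ, Real.log ‖c + w‖ * Real.exp (-‖w‖ ^ 2) =
    ∫ w : ℂ, (Real.log ‖w‖ + posLog (‖w‖⁻¹ * ‖c‖)) * Real.exp (-‖w‖ ^ 2) := by
  have key : ∀ θ : ℝ, ∫ w : ℂ, Real.log ‖c + circleMap 0 1 θ * w‖ * Real.exp (-‖w‖ ^ 2)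
      = ∫ w : ℂ, Real.log ‖c + w‖ * Real.exp (-‖w‖ ^ 2) := by
    intro θ
    rw [← rot_int (fun w => Real.log ‖c + w‖ * Real.exp (-‖w‖ ^ 2)) θ]
    simp
  have hI : Integrable (Function.uncurry fun (θ : ℝ) (w : ℂ) =>
      Real.log ‖c + circleMap 0 1 θ * w‖ * Real.exp (-‖w‖ ^ 2))
      ((volume.restrict (Set.uIoc 0 (2 * π))).prod volume) := by
    rw [integrable_prod_iff]
    · constructor
      · refine Filter.Eventually.of_forall fun θ => ?_
        have h := (rotation (Circle.exp θ)).measurePreserving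
        have := (h.integrable_comp_emb
          (rotation (Circle.exp θ)).toHomeomorph.measurableEmbedding).2 (log_gauss_int c)
        refine this.congr (Filter.Eventually.of_forall fun w => ?_)
        simp [circleMap, rotation_apply]
      · have : ∀ θ : ℝ, ∫ w : ℂ, ‖Real.log ‖c + circleMap 0 1 θ * w‖ * Real.exp (-‖w‖ ^ 2)‖
          = ∫ w : ℂ, ‖Real.log ‖c + w‖ * Real.exp (-‖w‖ ^ 2)‖ := by
          intro θ
          rw [← rot_int (fun w => ‖Real.log ‖c + w‖ * Real.exp (-‖w‖ ^ 2)‖) θ]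
          simp
        simp only [Function.uncurry, this]
        rw [integrable_const_iff]
        right
        constructor
        simp [Set.uIoc]
    · apply Measurable.aestronglyMeasurable
      have : Measurable (fun p : ℝ × ℂ => circleMap 0 1 p.1) := by
        have := (continuous_circleMap 0 1).measurable
        exact this.comp measurable_fst
      unfold Function.uncurry
      fun_prop
  have hsw := MeasureTheory.integral_integral_swap (hI)
  have h0 : ∫ w : ℂ, Real.log ‖c + w‖ * Real.exp (-‖w‖ ^ 2) =
      (2 * π)⁻¹ * ∫ θ in (0:ℝ)..2*π, ∫ w : ℂ, Real.log ‖c + circleMap 0 1 θ * w‖ * Real.exp (-‖w‖ ^ 2) := by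
    simp only [key]
    simp only [intervalIntegral.integral_const, smul_eq_mul]
    field_simp; simp; ring
  rw [h0, intervalIntegral.integral_of_le (by positivity)]
  rw [Set.uIoc_of_le (by positivity)] at hsw
  rw [hsw, ← integral_const_mul]
  have hne : ∀ᵐ w : ℂ, w ≠ 0 := by
    simp [ae_iff]
  apply integral_congr_ae
  filter_upwards [hne] with w hw
  rw [← intervalIntegral.integral_of_le (by positivity), intervalIntegral.integral_mul_const, ← mul_assoc]
  congr 1
  have := circleAverage_log_norm_sub_const_eq_log_radius_add_posLog (c := 0) (a := -c) (R := ‖w‖) (by simpa using hw)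
  simp only [zero_sub, neg_neg] at this
  rw [← this]
  rw [Real.circleAverage_eq_integral_add (Complex.arg w), smul_eq_mul]
  congr 1
  apply intervalIntegral.integral_congr
  intro θ _
  simp only
  congr 2
  have hw' := Complex.norm_mul_exp_arg_mul_I w
  simp only [circleMap, zero_add, sub_neg_eq_add]
  push_cast
  rw [add_mul, Complex.exp_add]
  simp only [one_mul]
  linear_combination (-Complex.exp (θ * Complex.I)) * hw'

noncomputable def mlog : ℝ := ∫ s in Set.Ioi (0:ℝ), Real.log s * Real.exp (-s)

noncomputable def Phi (v : ℝ) : ℝ :=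
  Real.log v * (1 - Real.exp (-v)) - ∫ t in (0:ℝ)..v, Real.log t * Real.exp (-t)

lemma pow_exp_int {p : ℝ} (hp : -1 < p) :
    IntegrableOn (fun s : ℝ => s ^ p * Real.exp (-s)) (Set.Ioi 0) := by
  have := Real.GammaIntegral_convergent (s := p + 1) (by linarith)
  refine this.congr_fun (fun x hx => ?_) measurableSet_Ioi
  simp [mul_comm]

lemma exp_int : IntegrableOn (fun s : ℝ => Real.exp (-s)) (Set.Ioi 0) := by
  simpa using pow_exp_int (p := 0) (by norm_num)

lemma exp_integral : ∫ s in Set.Ioi (0:ℝ), Real.exp (-s) = 1 := integral_exp_neg_Ioi_zero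

lemma s_exp_int : IntegrableOn (fun s : ℝ => s * Real.exp (-s)) (Set.Ioi 0) := by
  simpa using pow_exp_int (p := 1) (by norm_num)

lemma abs_log_le_quarter {x : ℝ} (hx : 0 < x) :
    |Real.log x| ≤ 4 * (x ^ (1/4:ℝ) + x ^ (-(1/4):ℝ)) := by
  have h1 := Real.log_le_rpow_div hx.le (ε := 1/4) (by norm_num)
  have h2 := Real.log_le_rpow_div (inv_pos.2 hx).le (ε := 1/4) (by norm_num)
  rw [Real.log_inv, Real.inv_rpow hx.le, ← Real.rpow_neg hx.le] at h2
  have h3 : 0 < x ^ (1/4:ℝ) := by positivity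
  have h4 : 0 < x ^ (-(1/4):ℝ) := by positivity
  rw [abs_le]
  constructor <;> linarith

lemma logsq_exp_int : IntegrableOn (fun s : ℝ => Real.log s ^ 2 * Real.exp (-s)) (Set.Ioi 0) := by
  have h := ((pow_exp_int (p := 1/2) (by norm_num)).add (pow_exp_int (p := -(1/2)) (by norm_num))).const_mul 32
  refine Integrable.mono' h (by fun_prop) ?_
  filter_upwards [ae_restrict_mem measurableSet_Ioi] with s hs
  have hs : 0 < s := hs
  have h1 := abs_log_le_quarter hs
  have h2 : s ^ (1/2:ℝ) = (s ^ (1/4:ℝ)) ^ 2 := by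
    rw [← Real.rpow_natCast, ← Real.rpow_mul hs.le]; norm_num
  have h3 : s ^ (-(1/2):ℝ) = (s ^ (-(1/4):ℝ)) ^ 2 := by
    rw [← Real.rpow_natCast, ← Real.rpow_mul hs.le]; norm_num
  rw [Real.norm_eq_abs, abs_mul, abs_of_pos (Real.exp_pos _), abs_pow]
  simp only [Pi.add_apply]
  rw [h2, h3, ← add_mul, ← mul_assoc]
  gcongr
  calc |Real.log s| ^ 2 ≤ (4 * (s ^ (1/4:ℝ) + s ^ (-(1/4):ℝ))) ^ 2 := by gcongr
    _ ≤ _ := by nlinarith [sq_nonneg (s ^ (1/4:ℝ) - s ^ (-(1/4):ℝ))]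

lemma log_exp_int : IntegrableOn (fun s : ℝ => Real.log s * Real.exp (-s)) (Set.Ioi 0) := by
  refine Integrable.mono' (exp_int.add logsq_exp_int) (by fun_prop)
    (Filter.Eventually.of_forall fun s => ?_)
  rw [Real.norm_eq_abs, abs_mul, abs_of_pos (Real.exp_pos _)]
  simp only [Pi.add_apply]
  nlinarith [sq_nonneg (|Real.log s| - 1), Real.exp_pos (-s), sq_abs (Real.log s), abs_nonneg (Real.log s),
    mul_nonneg (sq_nonneg (|Real.log s| - 1)) (Real.exp_pos (-s)).le, mul_nonneg (sq_nonneg (|Real.log s|)) (Real.exp_pos (-s)).le]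

lemma s_log_exp_int : IntegrableOn (fun s : ℝ => s * (Real.log s * Real.exp (-s))) (Set.Ioi 0) := by
  refine Integrable.mono' (logsq_exp_int.add (pow_exp_int (p := 2) (by norm_num))) (by fun_prop)
    (Filter.Eventually.of_forall fun s => ?_)
  rw [Real.norm_eq_abs, abs_mul, abs_mul, abs_of_pos (Real.exp_pos _)]
  simp only [Pi.add_apply, Real.rpow_two]
  have := two_mul_le_add_sq |s| |Real.log s|
  rw [sq_abs, sq_abs] at this
  have h3 := abs_nonneg s
  have h4 := abs_nonneg (Real.log s)
  have h5 : |s| * |Real.log s| ≤ s ^ 2 + Real.log s ^ 2 := by nlinarith [mul_nonneg h3 h4]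
  nlinarith [mul_le_mul_of_nonneg_right h5 (Real.exp_pos (-s)).le]

lemma log_exp_ii (a b : ℝ) (ha : 0 ≤ a) (hb : 0 ≤ b) :
    IntervalIntegrable (fun s : ℝ => Real.log s * Real.exp (-s)) volume a b := by
  rw [intervalIntegrable_iff]
  exact log_exp_int.mono_set (fun x hx => lt_of_le_of_lt (le_min ha hb) hx.1)

lemma posLog_ind {v t : ℝ} (hv : 0 ≤ v) (ht : 0 < t) :
    posLog (t⁻¹ * v) = (Set.Ioc 0 v).indicator (fun t => Real.log v - Real.log t) t := by
  rw [Set.indicator]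
  split_ifs with h
  · have hv' : 0 < v := h.1.trans_le h.2
    rw [posLog_eq_log, Real.log_mul (by positivity) (by positivity), Real.log_inv]
    · ring
    · rw [abs_of_nonneg (by positivity), inv_mul_eq_div, one_le_div ht]; exact h.2
  · rw [posLog_eq_zero_iff, abs_of_nonneg (by positivity), inv_mul_eq_div, div_le_one ht]
    by_contra! h'
    exact h ⟨ht, h'.le⟩

lemma H_formula {v : ℝ} (hv : 0 ≤ v) :
    ∫ t in Set.Ioi (0:ℝ), (Real.log t + posLog (t⁻¹ * v)) * Real.exp (-t) = mlog + Phi v := by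
  have e1 : ∫ t in Set.Ioi (0:ℝ), (Real.log t + posLog (t⁻¹ * v)) * Real.exp (-t) =
      ∫ t in Set.Ioi (0:ℝ), (Real.log t * Real.exp (-t) +
        (Set.Ioc 0 v).indicator (fun t => Real.log v * Real.exp (-t) - Real.log t * Real.exp (-t)) t) := by
    apply setIntegral_congr_fun measurableSet_Ioi
    intro t ht
    simp only
    rw [posLog_ind hv ht]
    simp only [Set.indicator]
    split_ifs <;> ring
  have h1 : IntervalIntegrable (fun t : ℝ => Real.log v * Real.exp (-t)) volume 0 v :=
    (by fun_prop : Continuous (fun t : ℝ => Real.log v * Real.exp (-t))).intervalIntegrable _ _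
  have h2 := log_exp_ii 0 v le_rfl hv
  have h3 := (intervalIntegrable_iff_integrableOn_Ioc_of_le hv).1 (h1.sub h2)
  rw [e1, integral_add log_exp_int]
  · rw [mlog]
    congr 1
    rw [integral_indicator measurableSet_Ioc, Measure.restrict_restrict measurableSet_Ioc,
      Set.inter_eq_left.2 (fun x hx => hx.1), ← intervalIntegral.integral_of_le hv,
      intervalIntegral.integral_sub h1 h2, intervalIntegral.integral_const_mul, Phi]
    congr 2
    rw [intervalIntegral.integral_comp_neg (fun x => Real.exp x)]
    simp
  · exact (h3.integrable_indicator measurableSet_Ioc).restrict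

noncomputable def gfun (u : ℝ) : ℝ := (1 - Real.exp (-u)) / u

lemma gfun_bound {u : ℝ} (hu : 0 ≤ u) : |gfun u| ≤ 1 := by
  rw [gfun]
  have h1 := Real.add_one_le_exp (-u)
  have h2 : Real.exp (-u) ≤ 1 := by rw [Real.exp_le_one_iff]; linarith
  rw [abs_of_nonneg (div_nonneg (by linarith) hu)]
  exact div_le_one_of_le₀ (by linarith) hu

lemma gfun_ii (v : ℝ) (hv : 0 ≤ v) : IntervalIntegrable gfun volume 0 v := by
  rw [intervalIntegrable_iff_integrableOn_Ioc_of_le hv]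
  refine Integrable.mono' (g := fun _ => (1:ℝ)) (by simp) ?_ ?_
  · apply Measurable.aestronglyMeasurable
    unfold gfun; fun_prop
  · filter_upwards [ae_restrict_mem measurableSet_Ioc] with s hs
    exact gfun_bound hs.1.le

lemma Phi_cont : ContinuousOn Phi (Set.Ici 0) := by
  unfold Phi
  apply ContinuousOn.sub
  · intro v hv
    rcases (show (0:ℝ) ≤ v from hv).eq_or_lt with rfl | hv
    · rw [ContinuousWithinAt]
      simp only [Real.log_zero, zero_mul]
      have h := (Real.continuous_mul_log.tendsto 0).mono_left (nhdsWithin_le_nhds (s := Set.Ici 0))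
      simp only [Real.log_zero, mul_zero] at h
      refine squeeze_zero_norm' ?_ (h.norm.trans (by simp))
      filter_upwards [self_mem_nhdsWithin] with v hv
      have hb := gfun_bound (show 0 ≤ v from hv)
      have : Real.log v * (1 - Real.exp (-v)) = gfun v * (v * Real.log v) := by
        rcases eq_or_ne v 0 with rfl | h
        · simp
        · rw [gfun]; field_simp
      rw [this, norm_mul]
      exact mul_le_of_le_one_left (norm_nonneg _) hb
    · apply ContinuousAt.continuousWithinAt
      have := Real.continuousAt_log hv.ne'
      fun_prop
  · intro v hv
    have hv : 0 ≤ v := hv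
    have := intervalIntegral.continuousOn_primitive_interval' (μ := volume) (a := 0) (b₁ := 0) (b₂ := v + 1)
      (log_exp_ii 0 (v+1) le_rfl (by linarith)) (by simp)
    rw [Set.uIcc_of_le (by linarith)] at this
    have h2 := this v ⟨hv, by linarith⟩
    refine h2.mono_of_mem_nhdsWithin ?_
    rw [← Set.Ici_inter_Iic]
    exact Filter.inter_mem self_mem_nhdsWithin (mem_nhdsWithin_of_mem_nhds (Iic_mem_nhds (by linarith)))

lemma Phi_deriv {v : ℝ} (hv : 0 < v) : HasDerivAt Phi (gfun v) v := by
  have hc : ContinuousAt (fun t : ℝ => Real.log t * Real.exp (-t)) v := by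
    have := Real.continuousAt_log hv.ne'
    fun_prop
  have h1 := intervalIntegral.integral_hasDerivAt_right (log_exp_ii 0 v le_rfl hv.le)
    (Measurable.stronglyMeasurable (by fun_prop)).stronglyMeasurableAtFilter hc
  have h2 := ((Real.hasDerivAt_log hv.ne').mul ((hasDerivAt_id v).neg.exp.const_sub 1)).sub h1
  have h3 : HasDerivAt Phi _ v := h2
  refine h3.congr_deriv ?_
  simp [gfun]
  field_simp

lemma Phi_zero : Phi 0 = 0 := by simp [Phi]

lemma Phi_eq {v : ℝ} (hv : 0 ≤ v) : Phi v = ∫ u in (0:ℝ)..v, gfun u := by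
  rw [intervalIntegral.integral_eq_sub_of_hasDerivAt_of_le hv (Phi_cont.mono fun x hx => hx.1)
    (fun x hx => Phi_deriv hx.1) (gfun_ii v hv), Phi_zero, sub_zero]

lemma Phi_bound {v : ℝ} (hv : 0 ≤ v) : |Phi v| ≤ v := by
  rw [Phi_eq hv]
  have := intervalIntegral.norm_integral_le_of_norm_le_const (a := 0) (b := v) (C := 1) (f := gfun)
    (fun x hx => gfun_bound (by rw [Set.uIoc_of_le hv] at hx; exact hx.1.le))
  simpa [abs_of_nonneg hv] using this

lemma Phi_scale {b s : ℝ} (hb : 0 ≤ b) (hs : 0 < s) :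
    Phi (b * s) = ∫ u in Set.Ioc (0:ℝ) b, (1 - Real.exp (-(u * s))) / u := by
  rw [Phi_eq (by positivity), ← intervalIntegral.integral_of_le hb]
  have h := intervalIntegral.integral_comp_mul_right (a := 0) (b := b) gfun hs.ne'
  rw [zero_mul, smul_eq_mul] at h
  have h' : ∫ x in (0:ℝ)..b * s, gfun x = s * ∫ x in (0:ℝ)..b, gfun (x * s) := by
    rw [h]; field_simp
  rw [h', ← intervalIntegral.integral_const_mul]
  apply intervalIntegral.integral_congr
  intro u _
  simp only [gfun]
  rcases eq_or_ne u 0 with rfl | hu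
  · simp
  · field_simp

lemma cent_exp_int : IntegrableOn (fun s : ℝ => (Real.log s - mlog) * Real.exp (-s)) (Set.Ioi 0) := by
  refine (log_exp_int.sub (exp_int.const_mul mlog)).congr (Filter.Eventually.of_forall fun s => ?_)
  simp; ring

lemma cent_integral : ∫ s in Set.Ioi (0:ℝ), (Real.log s - mlog) * Real.exp (-s) = 0 := by
  simp only [sub_mul]
  rw [integral_sub log_exp_int (exp_int.const_mul mlog), integral_const_mul, exp_integral, mlog]
  ring

lemma s_cent_exp_int :
    IntegrableOn (fun s : ℝ => s * ((Real.log s - mlog) * Real.exp (-s))) (Set.Ioi 0) := by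
  refine (s_log_exp_int.sub (s_exp_int.const_mul mlog)).congr (Filter.Eventually.of_forall fun s => ?_)
  simp; ring

lemma cent_scaled {c : ℝ} (hc : 0 < c) :
    ∫ s in Set.Ioi (0:ℝ), (Real.log s - mlog) * Real.exp (-(c * s)) = - Real.log c / c := by
  have h := integral_comp_mul_left_Ioi
    (fun x : ℝ => (Real.log x - mlog) * Real.exp (-x) - Real.log c * Real.exp (-x)) 0 hc
  rw [mul_zero, integral_sub cent_exp_int (exp_int.const_mul _), integral_const_mul, exp_integral,
    cent_integral, smul_eq_mul] at h
  rw [show - Real.log c / c = c⁻¹ * (0 - Real.log c * 1) by field_simp; ring, ← h]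
  apply setIntegral_congr_fun measurableSet_Ioi
  intro s hs
  simp only
  rw [Real.log_mul hc.ne' (ne_of_gt hs)]
  ring

lemma cent_scaled_int {c : ℝ} (hc : 1 ≤ c) :
    IntegrableOn (fun s : ℝ => (Real.log s - mlog) * Real.exp (-(c * s))) (Set.Ioi 0) := by
  refine Integrable.mono' cent_exp_int.norm (by fun_prop) ?_
  filter_upwards [ae_restrict_mem measurableSet_Ioi] with s hs
  rw [norm_mul, norm_mul]
  have hs : 0 < s := hs
  gcongr
  rw [Real.norm_eq_abs, Real.norm_eq_abs, Real.abs_exp, Real.abs_exp, Real.exp_le_exp]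
  nlinarith

lemma inner_u {u : ℝ} (hu : 0 < u) :
    ∫ s in Set.Ioi (0:ℝ), (Real.log s - mlog) * Real.exp (-s) * ((1 - Real.exp (-(u * s))) / u)
      = Real.log (1 + u) / (u * (1 + u)) := by
  have e : ∀ s : ℝ, (Real.log s - mlog) * Real.exp (-s) * ((1 - Real.exp (-(u * s))) / u) =
      u⁻¹ * ((Real.log s - mlog) * Real.exp (-s) - (Real.log s - mlog) * Real.exp (-((1 + u) * s))) := by
    intro s
    rw [show -((1 + u) * s) = -s + -(u * s) by ring, Real.exp_add]
    field_simp
  simp only [e]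
  rw [integral_const_mul, integral_sub cent_exp_int (cent_scaled_int (by linarith)), cent_integral,
    cent_scaled (by linarith)]
  field_simp
  ring

lemma fub {b : ℝ} (hb : 0 ≤ b) :
    ∫ s in Set.Ioi (0:ℝ), (Real.log s - mlog) * Real.exp (-s) * Phi (b * s)
      = ∫ u in (0:ℝ)..b, Real.log (1 + u) / (u * (1 + u)) := by
  have hI : Integrable (Function.uncurry fun (s u : ℝ) =>
      (Real.log s - mlog) * Real.exp (-s) * ((1 - Real.exp (-(u * s))) / u))
      ((volume.restrict (Set.Ioi 0)).prod (volume.restrict (Set.Ioc 0 b))) := by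
    have h1 : Integrable (fun _ : ℝ => (1:ℝ)) (volume.restrict (Set.Ioc 0 b)) := by simp
    have h2 := s_cent_exp_int.mul_prod h1
    refine Integrable.mono' h2.norm ?_ ?_
    · apply Measurable.aestronglyMeasurable
      unfold Function.uncurry
      fun_prop
    · rw [Measure.prod_restrict]
      filter_upwards [ae_restrict_mem (measurableSet_Ioi.prod measurableSet_Ioc)] with p hp
      obtain ⟨s, u⟩ := p
      have hs : 0 < s := hp.1
      have hu : 0 < u := hp.2.1
      have hg := gfun_bound (u := u * s) (by positivity)
      have : (1 - Real.exp (-(u * s))) / u = s * gfun (u * s) := by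
        rw [gfun]; field_simp
      simp only [Function.uncurry]
      rw [this, show (Real.log s - mlog) * Real.exp (-s) * (s * gfun (u * s)) =
        (s * ((Real.log s - mlog) * Real.exp (-s))) * gfun (u * s) by ring, norm_mul, mul_one]
      exact mul_le_of_le_one_right (norm_nonneg _) hg
  have hsw := MeasureTheory.integral_integral_swap hI
  rw [intervalIntegral.integral_of_le hb]
  calc _ = ∫ s in Set.Ioi (0:ℝ), ∫ u in Set.Ioc 0 b,
        (Real.log s - mlog) * Real.exp (-s) * ((1 - Real.exp (-(u * s))) / u) := by
        apply setIntegral_congr_fun measurableSet_Ioi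
        intro s hs
        simp only
        rw [integral_const_mul, Phi_scale hb hs]
    _ = _ := by
        rw [hsw]
        apply setIntegral_congr_fun measurableSet_Ioc
        intro u hu
        exact inner_u hu.1

noncomputable def Dil (p : ℝ) : ℝ := ∑' k : ℕ, (1 / ((k : ℝ) + 1) ^ 2) * p ^ (k + 1)

lemma sum_sq : Summable (fun k : ℕ => 1 / ((k : ℝ) + 1) ^ 2) := by
  have := (summable_nat_add_iff 1).2 (Real.summable_one_div_nat_pow.2 (one_lt_two))
  simpa using this

lemma Dil_cont : ContinuousOn Dil (Set.Icc 0 1) := by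
  unfold Dil
  refine continuousOn_tsum (u := fun k : ℕ => 1 / ((k : ℝ) + 1) ^ 2) (fun k => by fun_prop) sum_sq ?_
  intro k p hp
  rw [norm_mul, norm_pow, Real.norm_of_nonneg (by positivity), Real.norm_of_nonneg hp.1]
  exact mul_le_of_le_one_right (by positivity) (pow_le_one₀ hp.1 hp.2)

lemma Dil_zero : Dil 0 = 0 := by simp [Dil]

lemma Dil_deriv {p : ℝ} (hp0 : 0 < p) (hp : p < 1) :
    HasDerivAt Dil (- Real.log (1 - p) / p) p := by
  obtain ⟨r, hr, hr1⟩ := exists_between hp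
  have hr0 : 0 < r := hp0.trans hr
  have h := hasDerivAt_tsum_of_isPreconnected (u := fun k : ℕ => r ^ k) (t := Set.Ioo 0 r)
    (g := fun (k : ℕ) (p : ℝ) => (1 / ((k : ℝ) + 1) ^ 2) * p ^ (k + 1))
    (g' := fun (k : ℕ) (p : ℝ) => p ^ k / ((k : ℝ) + 1)) (y₀ := p) (y := p)
    (summable_geometric_of_lt_one hr0.le hr1) isOpen_Ioo isPreconnected_Ioo
    (fun k y hy => by
      have := (hasDerivAt_pow (k + 1) y).const_mul (1 / ((k : ℝ) + 1) ^ 2)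
      refine this.congr_deriv ?_
      push_cast
      simp
      field_simp)
    (fun k y hy => by
      have hy0 := hy.1
      rw [Real.norm_of_nonneg (by positivity)]
      calc y ^ k / ((k : ℝ) + 1) ≤ y ^ k := div_le_self (by positivity) (by simp)
        _ ≤ r ^ k := by gcongr; exact hy.2.le)
    ⟨hp0, hr⟩
    (by
      refine Summable.of_nonneg_of_le (fun k => by positivity) (fun k => ?_) sum_sq
      exact mul_le_of_le_one_right (by positivity) (pow_le_one₀ hp0.le hp.le))
    ⟨hp0, hr⟩
  have h' : HasDerivAt Dil _ p := h
  refine h'.congr_deriv ?_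
  have hl := (Real.hasSum_pow_div_log_of_abs_lt_one (x := p) (by rw [abs_of_pos hp0]; exact hp)).mul_right p⁻¹
  rw [← div_eq_mul_inv] at hl
  rw [← hl.tsum_eq]
  congr 1; ext k
  rw [pow_succ]; field_simp

lemma int_Dil {b : ℝ} (hb : 0 ≤ b) :
    ∫ u in (0:ℝ)..b, Real.log (1 + u) / (u * (1 + u)) = Dil (b / (1 + b)) := by
  have hii : IntervalIntegrable (fun u : ℝ => Real.log (1 + u) / (u * (1 + u))) volume 0 b := by
    rw [intervalIntegrable_iff_integrableOn_Ioc_of_le hb]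
    refine Integrable.mono' (g := fun _ => (1:ℝ)) (by simp) ?_ ?_
    · apply Measurable.aestronglyMeasurable
      fun_prop
    · filter_upwards [ae_restrict_mem measurableSet_Ioc] with u hu
      have hu := hu.1
      have h1 := Real.log_le_sub_one_of_pos (x := 1 + u) (by linarith)
      have h0 := Real.log_nonneg (x := 1 + u) (by linarith)
      rw [Real.norm_of_nonneg (by positivity)]
      apply div_le_one_of_le₀ _ (by positivity)
      nlinarith
  have := intervalIntegral.integral_eq_sub_of_hasDerivAt_of_le (f := fun u => Dil (u / (1 + u))) hb
    (by
      refine Dil_cont.comp (t := Set.Icc 0 1) ?_ ?_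
      · refine ContinuousOn.div (by fun_prop) (by fun_prop) ?_
        intro x hx
        have := hx.1
        positivity
      · intro x hx
        have := hx.1
        exact ⟨by positivity, div_le_one_of_le₀ (by linarith) (by linarith)⟩)
    (fun u hu => by
      have hu := hu.1
      have h1 : 1 + u ≠ 0 := by positivity
      have hd := (hasDerivAt_id u).div ((hasDerivAt_id u).const_add 1) h1
      have h2 := (Dil_deriv (p := u / (1 + u)) (by positivity)
        (by rw [div_lt_one (by positivity)]; linarith)).comp u hd
      refine h2.congr_deriv (g' := Real.log (1 + u) / (u * (1 + u))) ?_
      rw [show 1 - u / (1 + u) = (1 + u)⁻¹ by field_simp; ring, Real.log_inv]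
      simp
      field_simp) hii
  rw [this]
  simp [Dil_zero]

lemma cov_main {b : ℝ} (hb : 0 ≤ b) :
    ∫ s in Set.Ioi (0:ℝ), (Real.log s - mlog) * Real.exp (-s) * Phi (b * s) = Dil (b / (1 + b)) := by
  rw [fub hb, int_Dil hb]

lemma Phi_meas {b : ℝ} (hb : 0 ≤ b) :
    AEStronglyMeasurable (fun s => Phi (b * s)) (volume.restrict (Set.Ioi 0)) := by
  refine ContinuousOn.aestronglyMeasurable ?_ measurableSet_Ioi
  refine Phi_cont.comp (by fun_prop) ?_
  intro s hs
  have : 0 < s := hs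
  exact mul_nonneg hb this.le

lemma Phi_mul_int {b : ℝ} (hb : 0 ≤ b) {f : ℝ → ℝ}
    (hm : Measurable f)
    (hf : IntegrableOn (fun s => s * f s) (Set.Ioi 0)) :
    IntegrableOn (fun s => f s * Phi (b * s)) (Set.Ioi 0) := by
  refine Integrable.mono' (hf.norm.const_mul b) (hm.aestronglyMeasurable.mul (Phi_meas hb)) ?_
  filter_upwards [ae_restrict_mem measurableSet_Ioi] with s hs
  have hs : 0 < s := hs
  have := Phi_bound (v := b * s) (by positivity)
  rw [norm_mul, norm_mul, Real.norm_of_nonneg hs.le, Real.norm_eq_abs (Phi _)]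
  nlinarith [norm_nonneg (f s)]

lemma Rtend : Filter.Tendsto (fun v => Phi v + mlog - Real.log v) Filter.atTop (nhds 0) := by
  have h1 := intervalIntegral_tendsto_integral_Ioi 0 log_exp_int Filter.tendsto_id
  have h2 : Filter.Tendsto (fun v : ℝ => Real.log v * Real.exp (-v)) Filter.atTop (nhds 0) := by
    have h3 := Real.tendsto_pow_mul_exp_neg_atTop_nhds_zero 1
    refine squeeze_zero' ?_ ?_ h3
    · filter_upwards [Filter.eventually_ge_atTop 1] with v hv
      exact mul_nonneg (Real.log_nonneg hv) (Real.exp_pos _).le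
    · filter_upwards [Filter.eventually_ge_atTop 1] with v hv
      gcongr
      have := Real.log_le_sub_one_of_pos (x := v) (by linarith)
      simp; linarith
  have h4 := (h2.neg.add_const mlog).sub h1
  have e : -0 + mlog - mlog = 0 := by ring
  have h5 : Filter.Tendsto _ Filter.atTop (nhds (-0 + mlog - mlog)) := h4
  rw [e] at h5
  refine h5.congr (fun v => ?_)
  simp [Phi]; ring

lemma Rbound {v : ℝ} (hv : 0 < v) : |Phi v + mlog - Real.log v| ≤
    |Real.log v| * Real.exp (-v) + ∫ t in Set.Ioi (0:ℝ), |Real.log t * Real.exp (-t)| := by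
  have h1 := intervalIntegral.integral_Ioi_sub_Ioi (a := 0) (b := v) log_exp_int hv.le
  have e : Phi v + mlog - Real.log v = -(Real.log v * Real.exp (-v)) +
      ∫ t in Set.Ioi v, Real.log t * Real.exp (-t) := by
    rw [Phi, ← h1, mlog]; ring
  rw [e]
  refine (abs_add_le _ _).trans ?_
  rw [abs_neg, abs_mul, Real.abs_exp]
  gcongr
  rw [← Real.norm_eq_abs]
  refine (norm_integral_le_integral_norm _).trans ?_
  exact setIntegral_mono_set log_exp_int.norm (Filter.Eventually.of_forall fun x => abs_nonneg _)
    (Filter.Eventually.of_forall (Set.Ioi_subset_Ioi hv.le))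

lemma Rbound' {s : ℝ} (hs : 0 < s) (n : ℕ) (hn : 1 ≤ n) :
    |Phi (n * s) + mlog - Real.log (n * s)| ≤
    1 + |Real.log s| + ∫ t in Set.Ioi (0:ℝ), |Real.log t * Real.exp (-t)| := by
  have hn : (1:ℝ) ≤ n := by exact_mod_cast hn
  have hv : 0 < n * s := by positivity
  refine (Rbound hv).trans ?_
  gcongr
  rcases le_total 1 (n * s) with h | h
  · have h1 := Real.log_le_sub_one_of_pos hv
    have h2 := Real.add_one_le_exp (n * s)
    rw [abs_of_nonneg (Real.log_nonneg h)]
    have h3 : Real.log (n * s) * Real.exp (-(n * s)) ≤ 1 := by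
      rw [Real.exp_neg, ← div_eq_mul_inv]
      exact div_le_one_of_le₀ (by linarith) (Real.exp_pos _).le
    linarith [abs_nonneg (Real.log s)]
  · have h1 : Real.exp (-(n * s)) ≤ 1 := by rw [Real.exp_le_one_iff]; linarith
    have h2 : |Real.log (n * s)| ≤ |Real.log s| := by
      have hle : s ≤ n * s := by nlinarith
      rw [abs_of_nonpos (Real.log_nonpos hv.le h), abs_of_nonpos (Real.log_nonpos hs.le (hle.trans h))]
      have := Real.log_le_log hs hle
      linarith
    have := mul_le_of_le_one_right (abs_nonneg (Real.log (n * s))) h1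
    linarith

lemma cent_log_int :
    IntegrableOn (fun s : ℝ => (Real.log s - mlog) * Real.exp (-s) * Real.log s) (Set.Ioi 0) := by
  refine (logsq_exp_int.sub (log_exp_int.const_mul mlog)).congr (Filter.Eventually.of_forall fun s => ?_)
  simp; ring

lemma var_main :
    ∫ s in Set.Ioi (0:ℝ), (Real.log s - mlog) * Real.exp (-s) * Real.log s = Dil 1 := by
  set M := ∫ t in Set.Ioi (0:ℝ), |Real.log t * Real.exp (-t)| with hM
  have hcP : ∀ n : ℕ, IntegrableOn (fun s : ℝ => (Real.log s - mlog) * Real.exp (-s) * Phi (n * s)) (Set.Ioi 0) :=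
    fun n => Phi_mul_int (Nat.cast_nonneg n) (by fun_prop) s_cent_exp_int
  have hval : ∀ n : ℕ, 1 ≤ n → ∫ s in Set.Ioi (0:ℝ), (Real.log s - mlog) * Real.exp (-s) *
      (Phi (n * s) + mlog - Real.log (n * s)) = Dil (n / (1 + n)) -
      ∫ s in Set.Ioi (0:ℝ), (Real.log s - mlog) * Real.exp (-s) * Real.log s := by
    intro n hn
    have hn' : (n : ℝ) ≠ 0 := by positivity
    have e : ∀ s ∈ Set.Ioi (0:ℝ), (Real.log s - mlog) * Real.exp (-s) *
      (Phi (n * s) + mlog - Real.log (n * s)) = (Real.log s - mlog) * Real.exp (-s) * Phi (n * s) +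
        (mlog - Real.log n) * ((Real.log s - mlog) * Real.exp (-s)) -
        (Real.log s - mlog) * Real.exp (-s) * Real.log s := by
      intro s hs
      rw [Real.log_mul hn' (ne_of_gt hs)]
      ring
    rw [setIntegral_congr_fun measurableSet_Ioi e,
      integral_sub (f := fun s => (Real.log s - mlog) * Real.exp (-s) * Phi (n * s) +
        (mlog - Real.log n) * ((Real.log s - mlog) * Real.exp (-s)))
        ((hcP n).add (cent_exp_int.const_mul _)) cent_log_int,
      integral_add (hcP n) (cent_exp_int.const_mul _), integral_const_mul, cent_integral,
      cov_main (Nat.cast_nonneg n)]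
    ring
  have hl1 : Filter.Tendsto (fun n : ℕ => ∫ s in Set.Ioi (0:ℝ), (Real.log s - mlog) * Real.exp (-s) *
      (Phi ((n + 1 : ℕ) * s) + mlog - Real.log ((n + 1 : ℕ) * s))) Filter.atTop
      (nhds (∫ s in Set.Ioi (0:ℝ), (0:ℝ))) := by
    refine tendsto_integral_of_dominated_convergence
      (fun s => ‖(Real.log s - mlog) * Real.exp (-s) * (1 + |Real.log s| + M)‖) ?_ ?_ ?_ ?_
    · intro n
      apply AEStronglyMeasurable.mul (by fun_prop)
      exact ((Phi_meas (Nat.cast_nonneg _)).add (by fun_prop)).sub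
        (Measurable.aestronglyMeasurable (by fun_prop))
    · apply Integrable.norm
      have h1 := (cent_exp_int.const_mul (1 + M)).norm.add cent_log_int.norm
      refine Integrable.mono' h1 (by fun_prop) (Filter.Eventually.of_forall fun s => ?_)
      simp only [Pi.add_apply]
      rw [show (Real.log s - mlog) * Real.exp (-s) * (1 + |Real.log s| + M) =
        (1 + M) * ((Real.log s - mlog) * Real.exp (-s)) +
          (Real.log s - mlog) * Real.exp (-s) * |Real.log s| by ring]
      refine (norm_add_le _ _).trans ?_
      simp
    · intro n
      filter_upwards [ae_restrict_mem measurableSet_Ioi] with s hs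
      rw [norm_mul, norm_mul _ (1 + |Real.log s| + M)]
      gcongr
      rw [Real.norm_eq_abs, Real.norm_eq_abs]
      exact (Rbound' hs (n + 1) (by omega)).trans (le_abs_self _)
    · filter_upwards [ae_restrict_mem measurableSet_Ioi] with s hs
      have hs : 0 < s := hs
      have ht : Filter.Tendsto (fun n : ℕ => ((n + 1 : ℕ) : ℝ) * s) Filter.atTop Filter.atTop :=
        (tendsto_natCast_atTop_atTop.comp (Filter.tendsto_add_atTop_nat 1)).atTop_mul_const hs
      simpa using (Rtend.comp ht).const_mul ((Real.log s - mlog) * Real.exp (-s))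
  simp only [integral_zero] at hl1
  have hl2 : Filter.Tendsto (fun n : ℕ => Dil (((n + 1 : ℕ) : ℝ) / (1 + ((n + 1 : ℕ) : ℝ))) -
      ∫ s in Set.Ioi (0:ℝ), (Real.log s - mlog) * Real.exp (-s) * Real.log s) Filter.atTop
      (nhds (Dil 1 - ∫ s in Set.Ioi (0:ℝ), (Real.log s - mlog) * Real.exp (-s) * Real.log s)) := by
    apply Filter.Tendsto.sub_const
    have hc := Dil_cont 1 (by simp)
    refine hc.tendsto.comp (tendsto_nhdsWithin_iff.2 ⟨?_, Filter.Eventually.of_forall fun n => ?_⟩)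
    · have := (tendsto_natCast_div_add_atTop (𝕜 := ℝ) 1).comp (Filter.tendsto_add_atTop_nat 1)
      refine this.congr fun n => ?_
      simp [add_comm]
    · exact ⟨by positivity, div_le_one_of_le₀ (by linarith) (by positivity)⟩
  have := tendsto_nhds_unique hl1 (hl2.congr fun n => (hval (n + 1) (by omega)).symm)
  linarith

lemma half_log_sq (x : ℝ) : Real.log x = (1/2) * Real.log (x ^ 2) := by
  rw [Real.log_pow]; push_cast; ring

lemma half_posLog_sq (x : ℝ) : posLog x = (1/2) * posLog (x ^ 2) := by
  rw [posLog, posLog, half_log_sq x]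
  rcases le_total 0 (Real.log (x ^ 2)) with h | h
  · rw [max_eq_right h, max_eq_right (by linarith)]
  · rw [max_eq_left h, max_eq_left (by linarith)]; ring

lemma jensen_val (c : ℂ) :
    ∫ w : ℂ, Real.log ‖c + w‖ * Real.exp (-‖w‖ ^ 2) = π * ((1/2) * (mlog + Phi (‖c‖ ^ 2))) := by
  rw [jensen_int, ← H_formula (sq_nonneg _), ← integral_const_mul, ← radial_int]
  congr 1; ext w
  rw [half_log_sq, half_posLog_sq, mul_pow, inv_pow]
  ring

lemma gauss_val : ∫ w : ℂ, Real.exp (-‖w‖ ^ 2) = π := by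
  rw [radial_int (fun s => Real.exp (-s)), exp_integral, mul_one]

lemma inner_val (β γ : ℂ) (hγ : γ ≠ 0) (z : ℂ) :
    ∫ w : ℂ, Real.log ‖β * z + γ * w‖ * Real.exp (-‖w‖ ^ 2) =
      π * ((Real.log ‖γ‖ + (1/2) * mlog) + (1/2) * Phi (‖β‖ ^ 2 / ‖γ‖ ^ 2 * ‖z‖ ^ 2)) := by
  have hne : ∀ᵐ w : ℂ, w ≠ -(β * z / γ) := by simp [ae_iff]
  have e : ∫ w : ℂ, Real.log ‖β * z + γ * w‖ * Real.exp (-‖w‖ ^ 2) =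
      ∫ w : ℂ, (Real.log ‖γ‖ * Real.exp (-‖w‖ ^ 2) +
        Real.log ‖β * z / γ + w‖ * Real.exp (-‖w‖ ^ 2)) := by
    apply integral_congr_ae
    filter_upwards [hne] with w hw
    have h1 : β * z / γ + w ≠ 0 := fun h => hw (by linear_combination h)
    rw [show β * z + γ * w = γ * (β * z / γ + w) by field_simp, norm_mul,
      Real.log_mul (norm_ne_zero_iff.2 hγ) (norm_ne_zero_iff.2 h1)]
    ring
  rw [e, integral_add (gauss_int.const_mul _) (log_gauss_int _), integral_const_mul, gauss_val, jensen_val]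
  rw [norm_div, norm_mul, div_pow, mul_pow, mul_div_right_comm]
  ring

lemma reduce (α β γ : ℂ) (hα : α ≠ 0) (c0 : ℝ) (P : ℝ → ℝ)
    (hP : IntegrableOn (fun s => Real.exp (-s) * P s) (Set.Ioi 0))
    (hlP : IntegrableOn (fun s => Real.log s * Real.exp (-s) * P s) (Set.Ioi 0))
    (hG : ∀ z : ℂ, z ≠ 0 → ∫ w : ℂ, Real.log ‖β * z + γ * w‖ * Real.exp (-‖w‖ ^ 2) =
      π * (c0 + (1/2) * P (‖z‖ ^ 2))) :
    ((1 / π ^ 2) *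
        ∫ z : ℂ, ∫ w : ℂ,
          Real.log ‖α * z‖ * Real.log ‖β * z + γ * w‖ * Real.exp (-‖z‖ ^ 2 - ‖w‖ ^ 2))
      - ((1 / π ^ 2) *
          ∫ z : ℂ, ∫ w : ℂ, Real.log ‖α * z‖ * Real.exp (-‖z‖ ^ 2 - ‖w‖ ^ 2)) *
        ((1 / π ^ 2) *
          ∫ z : ℂ, ∫ w : ℂ, Real.log ‖β * z + γ * w‖ * Real.exp (-‖z‖ ^ 2 - ‖w‖ ^ 2))
      = (1 / 4) * ∫ s in Set.Ioi (0:ℝ), (Real.log s - mlog) * Real.exp (-s) * P s := by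
  have hne : ∀ᵐ z : ℂ, z ≠ 0 := by simp [ae_iff]
  have hsplit : ∀ z w : ℂ, Real.exp (-‖z‖ ^ 2 - ‖w‖ ^ 2) =
      Real.exp (-‖z‖ ^ 2) * Real.exp (-‖w‖ ^ 2) := by
    intro z w; rw [← Real.exp_add]; ring_nf
  have hlog : ∀ z : ℂ, z ≠ 0 → Real.log ‖α * z‖ = Real.log ‖α‖ + (1/2) * Real.log (‖z‖ ^ 2) := by
    intro z hz
    rw [norm_mul, Real.log_mul (norm_ne_zero_iff.2 hα) (norm_ne_zero_iff.2 hz), half_log_sq ‖z‖]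
  set la := Real.log ‖α‖
  set A := ∫ s in Set.Ioi (0:ℝ), Real.exp (-s) * P s with hA
  set B := ∫ s in Set.Ioi (0:ℝ), Real.log s * Real.exp (-s) * P s with hB
  have i1 : ∫ z : ℂ, ∫ w : ℂ,
      Real.log ‖α * z‖ * Real.log ‖β * z + γ * w‖ * Real.exp (-‖z‖ ^ 2 - ‖w‖ ^ 2) =
      π * (π * (la * c0 + (1/2) * la * A + (1/2) * c0 * mlog + (1/4) * B)) := by
    calc _ = ∫ z : ℂ, (fun s : ℝ => π * ((la * c0) * Real.exp (-s) + ((1/2) * la) * (Real.exp (-s) * P s)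
            + (((1/2) * c0) * (Real.log s * Real.exp (-s))
            + (1/4) * (Real.log s * Real.exp (-s) * P s)))) (‖z‖ ^ 2) := by
          apply integral_congr_ae
          filter_upwards [hne] with z hz
          have : ∀ w : ℂ, Real.log ‖α * z‖ * Real.log ‖β * z + γ * w‖ * Real.exp (-‖z‖ ^ 2 - ‖w‖ ^ 2)
            = (Real.log ‖α * z‖ * Real.exp (-‖z‖ ^ 2)) *
              (Real.log ‖β * z + γ * w‖ * Real.exp (-‖w‖ ^ 2)) := by
            intro w; rw [hsplit]; ring
          simp only [this]
          rw [integral_const_mul, hG z hz, hlog z hz]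
          ring
      _ = _ := by
          refine (radial_int
            (fun s : ℝ => π * ((la * c0) * Real.exp (-s) + ((1/2) * la) * (Real.exp (-s) * P s)
              + (((1/2) * c0) * (Real.log s * Real.exp (-s))
              + (1/4) * (Real.log s * Real.exp (-s) * P s))))).trans ?_
          rw [integral_const_mul, integral_add
            (f := fun s => (la * c0) * Real.exp (-s) + ((1/2) * la) * (Real.exp (-s) * P s))
            (g := fun s => ((1/2) * c0) * (Real.log s * Real.exp (-s))
              + (1/4) * (Real.log s * Real.exp (-s) * P s))
            ((exp_int.const_mul _).add (hP.const_mul _))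
            ((log_exp_int.const_mul _).add (hlP.const_mul _)),
            integral_add (exp_int.const_mul _) (hP.const_mul _),
            integral_add (log_exp_int.const_mul _) (hlP.const_mul _)]
          simp only [integral_const_mul]
          rw [exp_integral, ← hA, ← hB, ← mlog]
          ring
  have i2 : ∫ z : ℂ, ∫ w : ℂ, Real.log ‖α * z‖ * Real.exp (-‖z‖ ^ 2 - ‖w‖ ^ 2) =
      π * (π * (la + (1/2) * mlog)) := by
    calc _ = ∫ z : ℂ, (fun s : ℝ => π * (la * Real.exp (-s) + (1/2) * (Real.log s * Real.exp (-s))))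
            (‖z‖ ^ 2) := by
          apply integral_congr_ae
          filter_upwards [hne] with z hz
          simp only [hsplit, ← mul_assoc]
          rw [integral_const_mul, gauss_val, hlog z hz]
          ring
      _ = _ := by
          refine (radial_int
            (fun s : ℝ => π * (la * Real.exp (-s) + (1/2) * (Real.log s * Real.exp (-s))))).trans ?_
          rw [integral_const_mul, integral_add (exp_int.const_mul _)
            (log_exp_int.const_mul _)]
          simp only [integral_const_mul]
          rw [exp_integral, ← mlog]
          ring
  have i3 : ∫ z : ℂ, ∫ w : ℂ, Real.log ‖β * z + γ * w‖ * Real.exp (-‖z‖ ^ 2 - ‖w‖ ^ 2) =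
      π * (π * (c0 + (1/2) * A)) := by
    calc _ = ∫ z : ℂ, (fun s : ℝ => π * (c0 * Real.exp (-s) + (1/2) * (Real.exp (-s) * P s)))
            (‖z‖ ^ 2) := by
          apply integral_congr_ae
          filter_upwards [hne] with z hz
          have : ∀ w : ℂ, Real.log ‖β * z + γ * w‖ * Real.exp (-‖z‖ ^ 2 - ‖w‖ ^ 2)
            = Real.exp (-‖z‖ ^ 2) * (Real.log ‖β * z + γ * w‖ * Real.exp (-‖w‖ ^ 2)) := by
            intro w; rw [hsplit]; ring
          simp only [this]
          rw [integral_const_mul, hG z hz]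
          ring
      _ = _ := by
          refine (radial_int
            (fun s : ℝ => π * (c0 * Real.exp (-s) + (1/2) * (Real.exp (-s) * P s)))).trans ?_
          rw [integral_const_mul, integral_add (exp_int.const_mul _)
            (hP.const_mul _)]
          simp only [integral_const_mul]
          rw [exp_integral, ← hA]
          ring
  have hf : ∫ s in Set.Ioi (0:ℝ), (Real.log s - mlog) * Real.exp (-s) * P s = B - mlog * A := by
    rw [hA, hB, ← integral_const_mul, ← integral_sub hlP (hP.const_mul _)]
    congr 1; ext s; ring
  rw [i1, i2, i3, hf]
  have := Real.pi_ne_zero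
  field_simp
  ring

/-- Covariance of logarithms of jointly centered complex Gaussians
`ξ = α ξ₁ ~ N_ℂ(0,σ²)`, `η = β ξ₁ + γ ξ₂ ~ N_ℂ(0,τ²)`, with `ξ₁, ξ₂` independent
standard complex Gaussians.  Here `E[ξ conj η] = α conj β`, `E|ξ|² = ‖α‖²`,
`E|η|² = ‖β‖² + ‖γ‖²`. -/
theorem stmt7 (α β γ : ℂ) (hα : α ≠ 0) (hτ : β ≠ 0 ∨ γ ≠ 0) :
    ((1 / π ^ 2) *
        ∫ z : ℂ, ∫ w : ℂ,
          Real.log ‖α * z‖ * Real.log ‖β * z + γ * w‖ * Real.exp (-‖z‖ ^ 2 - ‖w‖ ^ 2))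
      - ((1 / π ^ 2) *
          ∫ z : ℂ, ∫ w : ℂ, Real.log ‖α * z‖ * Real.exp (-‖z‖ ^ 2 - ‖w‖ ^ 2)) *
        ((1 / π ^ 2) *
          ∫ z : ℂ, ∫ w : ℂ, Real.log ‖β * z + γ * w‖ * Real.exp (-‖z‖ ^ 2 - ‖w‖ ^ 2))
      = (1 / 4) * ∑' k : ℕ, (1 / ((k : ℝ) + 1) ^ 2) *
          (‖α * conj β‖ ^ 2 / (‖α‖ ^ 2 * (‖β‖ ^ 2 + ‖γ‖ ^ 2))) ^ (k + 1) := by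
  have ha : ‖α‖ ≠ 0 := norm_ne_zero_iff.2 hα
  have harg : ‖α * conj β‖ ^ 2 / (‖α‖ ^ 2 * (‖β‖ ^ 2 + ‖γ‖ ^ 2)) = ‖β‖ ^ 2 / (‖β‖ ^ 2 + ‖γ‖ ^ 2) := by
    rw [norm_mul, RCLike.norm_conj, mul_pow, mul_div_mul_left _ _ (pow_ne_zero 2 ha)]
  rw [harg]
  change _ = (1 / 4) * Dil (‖β‖ ^ 2 / (‖β‖ ^ 2 + ‖γ‖ ^ 2))
  rcases eq_or_ne γ 0 with rfl | hγ
  · have hβ : β ≠ 0 := by simpa using hτ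
    have hb : ‖β‖ ≠ 0 := norm_ne_zero_iff.2 hβ
    rw [reduce α β 0 hα (Real.log ‖β‖) Real.log
      (log_exp_int.congr (Filter.Eventually.of_forall fun s => by simp only; ring))
      (logsq_exp_int.congr (Filter.Eventually.of_forall fun s => by simp only; ring)) ?_, var_main]
    · simp [hb]
    · intro z hz
      simp only [zero_mul, add_zero]
      rw [integral_const_mul, gauss_val, norm_mul, Real.log_mul hb (norm_ne_zero_iff.2 hz),
        half_log_sq ‖z‖]
      ring
  · have hg : ‖γ‖ ≠ 0 := norm_ne_zero_iff.2 hγ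
    have hb : 0 ≤ ‖β‖ ^ 2 / ‖γ‖ ^ 2 := by positivity
    rw [reduce α β γ hα (Real.log ‖γ‖ + (1/2) * mlog) (fun s => Phi (‖β‖ ^ 2 / ‖γ‖ ^ 2 * s))
      (Phi_mul_int hb (by fun_prop) s_exp_int)
      (Phi_mul_int hb (by fun_prop) s_log_exp_int) (fun z _ => inner_val β γ hγ z), cov_main hb]
    congr 2
    field_simp
    ring
end
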